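/- arXiv:1307.2458 — 9 statements merged into one kernel-verified Lean document; each statement's English description precedes it below -/
import Mathlib

section
/- Define g(x) := x(x−1)(2x−1)/6 and B(x) := x(x−1)/2 for real x, and let {x} ∈ [0,1) denote the fractional part of x. Then the function h(a) := g(a) − g({a}) is differentiable at every a ∈ ℝ, with derivative h'(a) = 2·( B(a) − B({a}) ). -/
/-- `g(x) = x(x-1)(2x-1)/6`. -/
noncomputable def g (x : ℝ) : ℝ := x * (x - 1) * (2 * x - 1) / 6

/-- `B(x) = x(x-1)/2`. -/
noncomputable def B (x : ℝ) : ℝ := x * (x - 1) / 2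

theorem hasDerivAt_g (x : ℝ) : HasDerivAt g (2 * B x + 1 / 6) x := by
  have h := (((hasDerivAt_id x).mul ((hasDerivAt_id x).sub_const 1)).mul
    (((hasDerivAt_id x).const_mul 2).sub_const 1)).div_const 6
  refine h.congr_deriv ?_
  simp only [B, id, Pi.mul_apply]
  ring

/-- A function taking the same value at `0` and `1` may be evaluated at `x - m` instead of
`Int.fract x` on the whole closed interval `[m, m + 1]`. -/
theorem apply_fract_eq_apply_sub {f : ℝ → ℝ} (hf : f 0 = f 1) {m : ℤ} {x : ℝ}
    (hx : x ∈ Set.Icc (m : ℝ) (m + 1)) : f (Int.fract x) = f (x - m) := by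
  rcases hx.2.lt_or_eq with hlt | rfl
  · rw [Int.fract, Int.floor_eq_iff.2 ⟨hx.1, hlt⟩]
  · simp [hf]

theorem hasDerivWithinAt_g_sub_g_fract_Icc {m : ℤ} {a : ℝ}
    (ha : a ∈ Set.Icc (m : ℝ) (m + 1)) :
    HasDerivWithinAt (fun x : ℝ => g x - g (Int.fract x))
      (2 * (B a - B (Int.fract a))) (Set.Icc (m : ℝ) (m + 1)) a := by
  have hg : g 0 = g 1 := by simp [g]
  have hB : B 0 = B 1 := by simp [B]
  have h := ((hasDerivAt_g a).sub ((hasDerivAt_g (a - m)).comp_sub_const a (m : ℝ))).hasDerivWithinAt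
    (s := Set.Icc (m : ℝ) (m + 1))
  refine (h.congr_deriv ?_).congr_of_mem (fun x hx => ?_) ha
  · rw [apply_fract_eq_apply_sub hB ha]
    ring
  · simp only [Pi.sub_apply, apply_fract_eq_apply_sub hg hx]

theorem hasDerivAt_g_sub_g_fract (a : ℝ) :
    HasDerivAt (fun a : ℝ => g a - g (Int.fract a))
      (2 * (B a - B (Int.fract a))) a := by
  have hr := (hasDerivWithinAt_g_sub_g_fract_Icc (m := ⌊a⌋)
    ⟨Int.floor_le a, (Int.lt_floor_add_one a).le⟩).mono_of_mem_nhdsWithin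
    (Icc_mem_nhdsGE_of_mem ⟨Int.floor_le a, Int.lt_floor_add_one a⟩)
  have hlt : ((⌈a⌉ - 1 : ℤ) : ℝ) < a := by
    push_cast
    linarith [Int.ceil_lt_add_one a]
  have hle : a ≤ ((⌈a⌉ - 1 : ℤ) : ℝ) + 1 := by
    push_cast
    linarith [Int.le_ceil a]
  have hl := (hasDerivWithinAt_g_sub_g_fract_Icc ⟨hlt.le, hle⟩).mono_of_mem_nhdsWithin
    (Icc_mem_nhdsLE_of_mem ⟨hlt, hle⟩)
  simpa only [Set.Iic_union_Ici, hasDerivWithinAt_univ] using hl.union hr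
end

section
/- Let α ∈ ℝ⁶ with α₁ + ⋯ + α₆ = 1 and ζ ∈ ℝ. Define α' ∈ ℝ⁶ and ζ' ∈ ℝ by α'₁ = (1 + α₁ − α₂ − α₃ − ζ)/2, α'₂ = (1 − α₁ + α₂ − α₃ − ζ)/2, α'₃ = (1 − α₁ − α₂ + α₃ − ζ)/2, α'₄ = (α₄ − α₅ − α₆ + ζ)/2, α'₅ = (−α₄ + α₅ − α₆ + ζ)/2, α'₆ = (−α₄ − α₅ + α₆ + ζ)/2, and ζ' = (ζ + α₄ + α₅ + α₆)/2. Then α'₁ + ⋯ + α'₆ = 1 and fob(α', ζ') = fob(α, ζ). (This is the invariance of fob under the reflection in the root u = (−e₁−e₂−e₃+e₄+e₅+e₆+e₇−e₈)/2 generating, together with permutations of the α_r and integer translations, the affine Weyl group of type E₆.) -/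
/-- The first order behavior
`fob(α, ζ) = Σ_{1≤r<s≤6} g({α_r + α_s}) − Σ_{r=1}^{6} ( g({α_r − ζ}) + g({α_r + ζ}) )`. -/
noncomputable def fob (α : Fin 6 → ℝ) (ζ : ℝ) : ℝ :=
  (∑ r : Fin 6, ∑ s : Fin 6, if r < s then g (Int.fract (α r + α s)) else 0)
  - ∑ r : Fin 6, (g (Int.fract (α r - ζ)) + g (Int.fract (α r + ζ)))

theorem g_fract_neg (x : ℝ) : g (Int.fract (-x)) = -g (Int.fract x) := by
  by_cases h : Int.fract x = 0
  · rw [Int.fract_neg_eq_zero.mpr h, h]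
    simp [g]
  · rw [Int.fract_neg h]
    unfold g
    ring

theorem g_fract_one_sub (x : ℝ) : g (Int.fract (1 - x)) = -g (Int.fract x) := by
  rw [sub_eq_add_neg, Int.fract_one_add, g_fract_neg]

/-- Invariance of `fob` under the reflection in the root
`u = (−e₁−e₂−e₃+e₄+e₅+e₆+e₇−e₈)/2` of `E₆`. -/
theorem fob_reflection_invariance
    (α : Fin 6 → ℝ) (hsum : ∑ r, α r = 1) (ζ : ℝ) :
    ∀ α' : Fin 6 → ℝ, ∀ ζ' : ℝ,
      α' = ![(1 + α 0 - α 1 - α 2 - ζ) / 2, (1 - α 0 + α 1 - α 2 - ζ) / 2,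
             (1 - α 0 - α 1 + α 2 - ζ) / 2, (α 3 - α 4 - α 5 + ζ) / 2,
             (-α 3 + α 4 - α 5 + ζ) / 2, (-α 3 - α 4 + α 5 + ζ) / 2] →
      ζ' = (ζ + α 3 + α 4 + α 5) / 2 →
      (∑ r, α' r) = 1 ∧ fob α' ζ' = fob α ζ := by
  intro α' ζ' hα' hζ'
  simp only [Fin.sum_univ_six] at hsum
  have h0 : α' 0 = (1 + α 0 - α 1 - α 2 - ζ) / 2 := by simp [hα']
  have h1 : α' 1 = (1 - α 0 + α 1 - α 2 - ζ) / 2 := by simp [hα']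
  have h2 : α' 2 = (1 - α 0 - α 1 + α 2 - ζ) / 2 := by simp [hα']
  have h3 : α' 3 = (α 3 - α 4 - α 5 + ζ) / 2 := by simp [hα']
  have h4 : α' 4 = (-α 3 + α 4 - α 5 + ζ) / 2 := by simp [hα']
  have h5 : α' 5 = (-α 3 - α 4 + α 5 + ζ) / 2 := by simp [hα']
  clear hα'
  refine ⟨by rw [Fin.sum_univ_six]; linarith, ?_⟩
  simp only [fob, Fin.sum_univ_six, Fin.reduceLT, lt_self_iff_false, if_true, if_false]
  rw [show α' 1 + α' 2 = 1 - (α 0 + ζ) by linarith,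
    show α' 0 - ζ' = α 0 - ζ by linarith,
    show α' 0 + ζ' = 1 - (α 1 + α 2) by linarith,
    show α' 0 + α' 2 = 1 - (α 1 + ζ) by linarith,
    show α' 1 - ζ' = α 1 - ζ by linarith,
    show α' 1 + ζ' = 1 - (α 0 + α 2) by linarith,
    show α' 0 + α' 1 = 1 - (α 2 + ζ) by linarith,
    show α' 2 - ζ' = α 2 - ζ by linarith,
    show α' 2 + ζ' = 1 - (α 0 + α 1) by linarith,
    show α' 4 + α' 5 = -(α 3 - ζ) by linarith,
    show α' 3 - ζ' = -(α 4 + α 5) by linarith,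
    show α' 3 + ζ' = α 3 + ζ by linarith,
    show α' 3 + α' 5 = -(α 4 - ζ) by linarith,
    show α' 4 - ζ' = -(α 3 + α 5) by linarith,
    show α' 4 + ζ' = α 4 + ζ by linarith,
    show α' 3 + α' 4 = -(α 5 - ζ) by linarith,
    show α' 5 - ζ' = -(α 3 + α 4) by linarith,
    show α' 5 + ζ' = α 5 + ζ by linarith,
    show α' 0 + α' 3 = α 0 + α 3 by linarith,
    show α' 0 + α' 4 = α 0 + α 4 by linarith,
    show α' 0 + α' 5 = α 0 + α 5 by linarith,
    show α' 1 + α' 3 = α 1 + α 3 by linarith,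
    show α' 1 + α' 4 = α 1 + α 4 by linarith,
    show α' 1 + α' 5 = α 1 + α 5 by linarith,
    show α' 2 + α' 3 = α 2 + α 3 by linarith,
    show α' 2 + α' 4 = α 2 + α 4 by linarith,
    show α' 2 + α' 5 = α 2 + α 5 by linarith]
  simp only [g_fract_one_sub, g_fract_neg]
  ring
end

section
/- Let α ∈ ℝ⁶ with α₁ + ⋯ + α₆ = 1, let ζ ∈ ℝ, and let w ∈ ℤ⁶ with w₁ + ⋯ + w₆ = 2. Then fob(α, ζ) = − fob(w − α, ζ), where w − α denotes the componentwise difference (which satisfies Σ_r (w_r − α_r) = 1). -/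
theorem g_fract_intCast_sub (n : ℤ) (x : ℝ) : g (Int.fract (n - x)) = -g (Int.fract x) := by
  rw [sub_eq_add_neg, Int.fract_intCast_add]
  by_cases hx : Int.fract x = 0
  · simp [Int.fract_neg_eq_zero.mpr hx, hx, g]
  · rw [Int.fract_neg hx]
    unfold g
    ring

/-- `fob(α, ζ) = − fob(w − α, ζ)` for integer vectors `w` with `Σ w_r = 2`. -/
theorem fob_negating_reflection
    (α : Fin 6 → ℝ) (hsum : ∑ r, α r = 1) (ζ : ℝ)
    (w : Fin 6 → ℤ) (hw : ∑ r, w r = 2) :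
    fob α ζ = - fob (fun r => (w r : ℝ) - α r) ζ := by
  have hpair (r s : Fin 6) :
      g (Int.fract (w r - α r + (w s - α s))) = -g (Int.fract (α r + α s)) := by
    rw [← g_fract_intCast_sub (w r + w s)]
    push_cast
    ring_nf
  have hsub (r : Fin 6) : g (Int.fract (w r - α r - ζ)) = -g (Int.fract (α r + ζ)) := by
    rw [← g_fract_intCast_sub (w r), sub_sub]
  have hadd (r : Fin 6) : g (Int.fract (w r - α r + ζ)) = -g (Int.fract (α r - ζ)) := by
    rw [← g_fract_intCast_sub (w r), sub_sub_eq_add_sub, sub_add_eq_add_sub]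
  have hite (r s : Fin 6) (a : ℝ) : (if r < s then -a else 0) = -(if r < s then a else 0) := by
    split_ifs <;> simp
  simp only [fob, hpair, hsub, hadd, hite, Finset.sum_neg_distrib, Finset.sum_add_distrib]
  ring
end

section
/- Let α ∈ ℝ⁶ with α₁ + ⋯ + α₆ = 1. Then the function ζ ↦ fob(α, ζ) is differentiable at every ζ ∈ ℝ, with derivative equal to −2 · Σ_{r=1}^{6} ( B({α_r + ζ}) − B({α_r − ζ}) ), where B(x) := x(x−1)/2. In particular this derivative vanishes at ζ = 0 and at ζ = 1/2. -/
theorem g_fract_eq_of_mem_Icc {m : ℤ} {y : ℝ} (h : y ∈ Set.Icc (m : ℝ) (m + 1)) :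
    g (Int.fract y) = g (y - m) := by
  rcases h.2.lt_or_eq with hlt | rfl
  · rw [← Int.self_sub_floor, Int.floor_eq_iff.2 ⟨h.1, hlt⟩]
  · simp [g]

theorem B_fract_eq_of_mem_Icc {m : ℤ} {y : ℝ} (h : y ∈ Set.Icc (m : ℝ) (m + 1)) :
    B (Int.fract y) = B (y - m) := by
  rcases h.2.lt_or_eq with hlt | rfl
  · rw [← Int.self_sub_floor, Int.floor_eq_iff.2 ⟨h.1, hlt⟩]
  · simp [B]

theorem hasDerivWithinAt_g_fract {m : ℤ} {x : ℝ} (h : x ∈ Set.Icc (m : ℝ) (m + 1)) :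
    HasDerivWithinAt (fun y => g (Int.fract y)) (2 * B (Int.fract x) + 1 / 6)
      (Set.Icc (m : ℝ) (m + 1)) x := by
  rw [B_fract_eq_of_mem_Icc h]
  exact ((hasDerivAt_g (x - m)).comp_sub_const x (m : ℝ)).hasDerivWithinAt.congr
    (fun _ hy => g_fract_eq_of_mem_Icc hy) (g_fract_eq_of_mem_Icc h)

/-- The periodic extension of `g` is differentiable, also at the integers. -/
theorem hasDerivAt_g_fract (x : ℝ) :
    HasDerivAt (fun y => g (Int.fract y)) (2 * B (Int.fract x) + 1 / 6) x := by
  have hfl := Int.floor_le x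
  have hfl' := Int.lt_floor_add_one x
  have hce := Int.le_ceil x
  have hce' := Int.ceil_lt_add_one x
  have hr := hasDerivWithinAt_g_fract (m := ⌊x⌋) ⟨hfl, hfl'.le⟩
  have hl := hasDerivWithinAt_g_fract (m := ⌈x⌉ - 1) (x := x)
    ⟨by push_cast; linarith, by push_cast; linarith⟩
  refine (hl.union hr).hasDerivAt ?_
  have hnhds : Set.Ioo ((⌈x⌉ : ℝ) - 1) (⌊x⌋ + 1) ∈ nhds x :=
    Ioo_mem_nhds (by linarith) hfl'
  refine Filter.mem_of_superset hnhds fun y hy => ?_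
  rcases le_total y x with hyx | hxy
  · exact Or.inl ⟨by push_cast; exact hy.1.le, by push_cast; linarith⟩
  · exact Or.inr ⟨hfl.trans hxy, hy.2.le⟩

/-- `ζ ↦ fob(α, ζ)` is differentiable with derivative
`−2 Σ_r (B({α_r + ζ}) − B({α_r − ζ}))`, which vanishes at `ζ = 0` and `ζ = 1/2`. -/
theorem fob_hasDerivAt
    (α : Fin 6 → ℝ) (hsum : ∑ r, α r = 1) :
    (∀ ζ : ℝ, HasDerivAt (fun ζ : ℝ => fob α ζ)
        (-2 * ∑ r : Fin 6, (B (Int.fract (α r + ζ)) - B (Int.fract (α r - ζ)))) ζ)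
    ∧ (-2 * ∑ r : Fin 6, (B (Int.fract (α r + 0)) - B (Int.fract (α r - 0)))) = 0
    ∧ (-2 * ∑ r : Fin 6,
        (B (Int.fract (α r + 1 / 2)) - B (Int.fract (α r - 1 / 2)))) = 0 := by
  refine ⟨fun ζ => ?_, by simp, ?_⟩
  · have hterm (r : Fin 6) := ((hasDerivAt_g_fract (α r - ζ)).comp_const_sub (α r) ζ).add
      ((hasDerivAt_g_fract (α r + ζ)).comp_const_add (α r) ζ)
    have h := (HasDerivAt.fun_sum fun r (_ : r ∈ Finset.univ) => hterm r).const_sub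
      (∑ r : Fin 6, ∑ s : Fin 6, if r < s then g (Int.fract (α r + α s)) else 0)
    refine h.congr_deriv ?_
    rw [Finset.mul_sum, ← Finset.sum_neg_distrib]
    exact Finset.sum_congr rfl fun r _ => by ring
  · have h (r : Fin 6) : Int.fract (α r - 1 / 2) = Int.fract (α r + 1 / 2) := by
      rw [← Int.fract_sub_one (α r + 1 / 2)]
      congr 1
      ring
    simp only [h, sub_self, Finset.sum_const_zero, mul_zero]
end

section
/- Let α ∈ ℝ⁶ satisfy α₁ ≥ α₂ ≥ α₃ ≥ α₄ ≥ α₅ ≥ α₆ ≥ α₁ − 1 and α₁ + ⋯ + α₆ = 1. If α₁ + α₂ ≤ 1 and α₄ + α₅ ≤ 0, then ζ₀ := −α₄ − α₅ − α₆ lies in [0, 1/2] and for every ζ ∈ [0, 1/2] one has fob(α, ζ₀) ≤ fob(α, ζ); that is, on [0, 1/2] the function fob(α, ·) attains its minimum at ζ = −α₄ − α₅ − α₆. -/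
lemma g_fract_eq {x : ℝ} (hl : -2 ≤ x) (hu : x < 2) :
    g (Int.fract x) = g x + ((-x)⁺ ^ 2 + (-x - 1)⁺ ^ 2 - (x - 1)⁺ ^ 2) := by
  have key : ∀ n : ℤ, (n : ℝ) ≤ x → x < n + 1 → Int.fract x = x - n := fun n h₁ h₂ ↦ by
    rw [Int.fract, Int.floor_eq_iff.2 ⟨h₁, h₂⟩]
  rcases lt_or_ge x (-1) with h | h
  · rw [key (-2) (by push_cast; linarith) (by push_cast; linarith),
      posPart_eq_self.2 (by linarith : 0 ≤ -x), posPart_eq_self.2 (by linarith : 0 ≤ -x - 1),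
      posPart_eq_zero.2 (by linarith : x - 1 ≤ 0)]
    simp only [g]; push_cast; ring
  rcases lt_or_ge x 0 with h' | h'
  · rw [key (-1) (by push_cast; linarith) (by push_cast; linarith),
      posPart_eq_self.2 (by linarith : 0 ≤ -x), posPart_eq_zero.2 (by linarith : -x - 1 ≤ 0),
      posPart_eq_zero.2 (by linarith : x - 1 ≤ 0)]
    simp only [g]; push_cast; ring
  rcases lt_or_ge x 1 with h'' | h''
  · rw [key 0 (by push_cast; linarith) (by push_cast; linarith),
      posPart_eq_zero.2 (by linarith : -x ≤ 0), posPart_eq_zero.2 (by linarith : -x - 1 ≤ 0),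
      posPart_eq_zero.2 (by linarith : x - 1 ≤ 0)]
    simp only [g]; push_cast; ring
  · rw [key 1 (by push_cast; linarith) (by push_cast; linarith),
      posPart_eq_zero.2 (by linarith : -x ≤ 0), posPart_eq_zero.2 (by linarith : -x - 1 ≤ 0),
      posPart_eq_self.2 (by linarith : 0 ≤ x - 1)]
    simp only [g]; push_cast; ring

/-- For `|a| ≤ 1`, the dependence of `g {a - ζ} + g {a + ζ}` on `ζ` is piecewise quadratic. -/
lemma g_fract_sub_add_g_fract_add {a ζ : ℝ} (hl : -1 ≤ a) (hu : a ≤ 1) (h0 : 0 ≤ ζ)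
    (h1 : ζ ≤ 1 / 2) :
    g (Int.fract (a - ζ)) + g (Int.fract (a + ζ)) =
      2 * g a + (2 * a - 1) * ζ ^ 2 +
        ((-a - ζ)⁺ ^ 2 + (ζ - a)⁺ ^ 2 + (ζ - a - 1)⁺ ^ 2 - (a + ζ - 1)⁺ ^ 2) := by
  rw [g_fract_eq (by linarith) (by linarith), g_fract_eq (by linarith) (by linarith),
    posPart_eq_zero.2 (by linarith : -(a + ζ) - 1 ≤ 0),
    posPart_eq_zero.2 (by linarith : a - ζ - 1 ≤ 0), neg_sub, neg_add']
  simp only [g]; ring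

lemma g_fract_sub_add_g_fract_add_of_le {a ζ : ℝ} (h0 : 0 ≤ ζ) (h1 : ζ ≤ 1 / 2) (hζ : ζ ≤ a)
    (ha : a + ζ ≤ 1) :
    g (Int.fract (a - ζ)) + g (Int.fract (a + ζ)) = 2 * g a + (2 * a - 1) * ζ ^ 2 := by
  rw [g_fract_sub_add_g_fract_add (by linarith) (by linarith) h0 h1,
    posPart_eq_zero.2 (by linarith : -a - ζ ≤ 0), posPart_eq_zero.2 (by linarith : ζ - a ≤ 0),
    posPart_eq_zero.2 (by linarith : ζ - a - 1 ≤ 0),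
    posPart_eq_zero.2 (by linarith : a + ζ - 1 ≤ 0)]
  ring

lemma g_fract_sub_add_g_fract_add_of_sub_le_one {a ζ : ℝ} (h0 : 0 ≤ ζ) (h1 : ζ ≤ 1 / 2)
    (ha : ζ - a ≤ 1) (ha' : a + ζ ≤ 1) :
    g (Int.fract (a - ζ)) + g (Int.fract (a + ζ)) =
      2 * g a + (2 * a - 1) * ζ ^ 2 + ((-a - ζ)⁺ ^ 2 + (ζ - a)⁺ ^ 2) := by
  rw [g_fract_sub_add_g_fract_add (by linarith) (by linarith) h0 h1,
    posPart_eq_zero.2 (by linarith : ζ - a - 1 ≤ 0),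
    posPart_eq_zero.2 (by linarith : a + ζ - 1 ≤ 0)]
  ring

lemma g_fract_sub_add_g_fract_add_of_abs_le {a ζ : ℝ} (h1 : ζ ≤ 1 / 2) (ha : |a| ≤ ζ) :
    g (Int.fract (a - ζ)) + g (Int.fract (a + ζ)) =
      2 * g a + (2 * a - 1) * ζ ^ 2 + (ζ - a) ^ 2 := by
  obtain ⟨hl, hu⟩ := abs_le.1 ha
  rw [g_fract_sub_add_g_fract_add_of_sub_le_one (by linarith) h1 (by linarith) (by linarith),
    posPart_eq_zero.2 (by linarith : -a - ζ ≤ 0), posPart_eq_self.2 (by linarith : 0 ≤ ζ - a)]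
  ring

lemma posPart_sq_add_posPart_sq_le {u v w : ℝ} (huv : u ≤ v) (huw : 0 ≤ u + w) :
    u⁺ ^ 2 + v⁺ ^ 2 ≤ (-w)⁺ ^ 2 + (u + v + w) ^ 2 := by
  rcases le_total 0 w with hw | hw
  · rw [posPart_eq_zero.2 (by linarith : -w ≤ 0)]
    rcases le_total 0 u with hu | hu
    · rw [posPart_eq_self.2 hu, posPart_eq_self.2 (hu.trans huv)]
      nlinarith [mul_nonneg hu (hu.trans huv), mul_nonneg hu hw, mul_nonneg (hu.trans huv) hw]
    · rw [posPart_eq_zero.2 hu]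
      rcases le_total 0 v with hv | hv
      · rw [posPart_eq_self.2 hv]
        nlinarith [mul_nonneg hv huw]
      · rw [posPart_eq_zero.2 hv]
        nlinarith [sq_nonneg (u + v + w)]
  · rw [posPart_eq_self.2 (by linarith : 0 ≤ -w), posPart_eq_self.2 (by linarith : 0 ≤ u),
      posPart_eq_self.2 (by linarith : 0 ≤ v)]
    nlinarith [mul_nonneg huw (by linarith : 0 ≤ v + w)]

lemma four_posPart_sq_le {q t u v w : ℝ} (hqt : q ≤ t) (htu : t ≤ u) (huv : u ≤ v)
    (htw : t ≤ w) (huw : 0 ≤ u + w) :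
    q⁺ ^ 2 + t⁺ ^ 2 + u⁺ ^ 2 + v⁺ ^ 2 ≤ (-w)⁺ ^ 2 + (u + v + w) ^ 2 := by
  rcases le_total t 0 with ht | ht
  · rw [posPart_eq_zero.2 ht, posPart_eq_zero.2 (hqt.trans ht)]
    simpa using posPart_sq_add_posPart_sq_le huv huw
  · have hq : q⁺ ^ 2 ≤ t ^ 2 := by
      gcongr
      exact sup_le hqt ht
    rw [posPart_eq_self.2 ht, posPart_eq_self.2 (ht.trans htu),
      posPart_eq_self.2 (ht.trans (htu.trans huv)), posPart_eq_zero.2 (by linarith : -w ≤ 0)]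
    nlinarith [mul_nonneg ht (sub_nonneg.2 htu), mul_nonneg ht (sub_nonneg.2 huv),
      mul_nonneg ht (sub_nonneg.2 htw), mul_nonneg (sub_nonneg.2 htu) (sub_nonneg.2 huv),
      mul_nonneg (sub_nonneg.2 htu) (sub_nonneg.2 htw), sq_nonneg (u - t), sq_nonneg (w - t),
      mul_nonneg (sub_nonneg.2 huv) (sub_nonneg.2 htw)]

lemma posPart_sq_sum_le {a b c ζ : ℝ} (hζ : 0 ≤ ζ) (hab : b ≤ a) (hbc : c ≤ b) (hs : a + b ≤ 0)
    (h : ζ ≤ -a - b - c) :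
    (-a - ζ)⁺ ^ 2 + (ζ - a)⁺ ^ 2 + ((-b - ζ)⁺ ^ 2 + (ζ - b)⁺ ^ 2) +
      ((-c - ζ)⁺ ^ 2 + (ζ - c)⁺ ^ 2) ≤
      (ζ - a) ^ 2 + (ζ - b) ^ 2 + (ζ - c) ^ 2 + (ζ - (-a - b - c)) ^ 2 := by
  rw [posPart_eq_self.2 (by linarith : 0 ≤ ζ - b), posPart_eq_self.2 (by linarith : 0 ≤ ζ - c)]
  rcases le_total 0 (ζ - a) with h3 | h3
  · rw [posPart_eq_self.2 h3]
    rcases le_total 0 (-a - ζ) with h0 | h0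
    · rw [posPart_eq_self.2 h0, posPart_eq_self.2 (by linarith : 0 ≤ -b - ζ),
        posPart_eq_self.2 (by linarith : 0 ≤ -c - ζ)]
      nlinarith [mul_nonneg h0 (by linarith : 0 ≤ -b - ζ), mul_nonneg h0 (by linarith : 0 ≤ -c - ζ),
        mul_nonneg (by linarith : 0 ≤ -b - ζ) (by linarith : 0 ≤ -c - ζ), mul_nonneg hζ h0,
        mul_nonneg hζ (by linarith : 0 ≤ -b - ζ), mul_nonneg hζ (by linarith : 0 ≤ -c - ζ)]
    · rw [posPart_eq_zero.2 h0]
      rcases le_total 0 (-b - ζ) with h1 | h1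
      · rw [posPart_eq_self.2 h1, posPart_eq_self.2 (by linarith : 0 ≤ -c - ζ)]
        nlinarith [mul_nonneg h1 (by linarith : 0 ≤ -c - ζ),
          mul_nonneg h1 (by linarith : 0 ≤ ζ - a),
          mul_nonneg (by linarith : 0 ≤ -c - ζ) (by linarith : 0 ≤ ζ - a),
          mul_nonneg h1 (by linarith : 0 ≤ ζ + -a),
          mul_nonneg (by linarith : 0 ≤ -c - ζ) (by linarith : 0 ≤ ζ + -a)]
      · rw [posPart_eq_zero.2 h1]
        rcases le_total 0 (-c - ζ) with h2 | h2
        · rw [posPart_eq_self.2 h2]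
          nlinarith [mul_nonneg h2 (by linarith : 0 ≤ -a - b)]
        · rw [posPart_eq_zero.2 h2]
          nlinarith [sq_nonneg (ζ - (-a - b - c))]
  · rw [posPart_eq_zero.2 h3, posPart_eq_zero.2 (by linarith : -a - ζ ≤ 0),
      posPart_eq_self.2 (by linarith : 0 ≤ -b - ζ), posPart_eq_self.2 (by linarith : 0 ≤ -c - ζ)]
    nlinarith [mul_nonneg (by linarith : 0 ≤ -a - b) (by linarith : 0 ≤ -c - ζ),
      mul_nonneg (by linarith : 0 ≤ -a - b) (by linarith : 0 ≤ b - c),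
      mul_nonneg (by linarith : 0 ≤ a - ζ) (by linarith : 0 ≤ -c - ζ),
      mul_nonneg (by linarith : 0 ≤ a - ζ) (by linarith : 0 ≤ -b - ζ)]

/-- Case `α₁+α₂ ≤ 1`, `α₄+α₅ ≤ 0`: on `[0, 1/2]` the function `fob(α, ·)` attains
its minimum at `ζ₀ = −α₄−α₅−α₆ ∈ [0, 1/2]`. -/
theorem fob_min_at_internal_point
    (α : Fin 6 → ℝ)
    (h01 : α 1 ≤ α 0) (h12 : α 2 ≤ α 1) (h23 : α 3 ≤ α 2)
    (h34 : α 4 ≤ α 3) (h45 : α 5 ≤ α 4) (h50 : α 0 - 1 ≤ α 5)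
    (hsum : ∑ r, α r = 1)
    (hA : α 0 + α 1 ≤ 1) (hB : α 3 + α 4 ≤ 0) :
    (-α 3 - α 4 - α 5) ∈ Set.Icc (0 : ℝ) (1 / 2) ∧
      ∀ ζ ∈ Set.Icc (0 : ℝ) (1 / 2),
        fob α (-α 3 - α 4 - α 5) ≤ fob α ζ := by
  rw [Fin.sum_univ_six] at hsum
  generalize hz : -α 3 - α 4 - α 5 = z
  have hz0 : 0 ≤ z := by linarith
  have hz1 : z ≤ 1 / 2 := by linarith
  refine ⟨⟨hz0, hz1⟩, fun ζ ⟨hζ0, hζ1⟩ ↦ sub_le_sub_left ?_ _⟩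
  have hcoef (y : ℝ) : (α 0 + α 1 + α 2 + α 3 + α 4 + α 5) * y = y := by rw [hsum, one_mul]
  have hsq : (ζ - α 3) ^ 2 + (ζ - α 4) ^ 2 + (ζ - α 5) ^ 2 - 4 * ζ ^ 2 + (ζ - z) ^ 2 =
      (z - α 3) ^ 2 + (z - α 4) ^ 2 + (z - α 5) ^ 2 - 4 * z ^ 2 := by
    linear_combination 2 * (ζ - z) * hz
  have h3 : |α 3| ≤ z := abs_le.2 ⟨by linarith, by linarith⟩
  have h4 : |α 4| ≤ z := abs_le.2 ⟨by linarith, by linarith⟩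
  have h5 : |α 5| ≤ z := abs_le.2 ⟨by linarith, by linarith⟩
  simp only [Fin.sum_univ_six]
  rw [g_fract_sub_add_g_fract_add_of_le (a := α 0) (ζ := z) hz0 hz1 (by linarith) (by linarith),
    g_fract_sub_add_g_fract_add_of_le (a := α 1) (ζ := z) hz0 hz1 (by linarith) (by linarith),
    g_fract_sub_add_g_fract_add_of_le (a := α 2) (ζ := z) hz0 hz1 (by linarith) (by linarith),
    g_fract_sub_add_g_fract_add_of_abs_le hz1 h3, g_fract_sub_add_g_fract_add_of_abs_le hz1 h4,
    g_fract_sub_add_g_fract_add_of_abs_le hz1 h5]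
  rcases le_total ζ z with h | h
  · have key := posPart_sq_sum_le hζ0 h34 h45 hB (h.trans_eq hz.symm)
    rw [hz] at key
    rw [g_fract_sub_add_g_fract_add_of_le (a := α 0) hζ0 hζ1 (by linarith) (by linarith),
      g_fract_sub_add_g_fract_add_of_le (a := α 1) hζ0 hζ1 (by linarith) (by linarith),
      g_fract_sub_add_g_fract_add_of_le (a := α 2) hζ0 hζ1 (by linarith) (by linarith),
      g_fract_sub_add_g_fract_add_of_sub_le_one (a := α 3) hζ0 hζ1 (by linarith) (by linarith),
      g_fract_sub_add_g_fract_add_of_sub_le_one (a := α 4) hζ0 hζ1 (by linarith) (by linarith),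
      g_fract_sub_add_g_fract_add_of_sub_le_one (a := α 5) hζ0 hζ1 (by linarith) (by linarith)]
    linarith [hcoef (ζ ^ 2), hcoef (z ^ 2)]
  · have key := four_posPart_sq_le (by linarith : ζ - α 5 - 1 ≤ ζ - α 0)
      (by linarith : ζ - α 0 ≤ ζ - α 1) (by linarith : ζ - α 1 ≤ ζ - α 2)
      (by linarith : ζ - α 0 ≤ 1 - α 0 - ζ) (by linarith)
    rw [show -(1 - α 0 - ζ) = α 0 + ζ - 1 by ring,
      show ζ - α 1 + (ζ - α 2) + (1 - α 0 - ζ) = ζ - z by linarith] at key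
    rw [g_fract_sub_add_g_fract_add (a := α 0) (by linarith) (by linarith) hζ0 hζ1,
      g_fract_sub_add_g_fract_add_of_sub_le_one (a := α 1) hζ0 hζ1 (by linarith) (by linarith),
      g_fract_sub_add_g_fract_add_of_sub_le_one (a := α 2) hζ0 hζ1 (by linarith) (by linarith),
      g_fract_sub_add_g_fract_add_of_abs_le hζ1 (h3.trans h),
      g_fract_sub_add_g_fract_add_of_abs_le hζ1 (h4.trans h),
      g_fract_sub_add_g_fract_add (a := α 5) (by linarith) (by linarith) hζ0 hζ1,
      posPart_eq_zero.2 (by linarith : -α 0 - ζ ≤ 0),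
      posPart_eq_zero.2 (by linarith : ζ - α 0 - 1 ≤ 0),
      posPart_eq_zero.2 (by linarith : -α 1 - ζ ≤ 0),
      posPart_eq_zero.2 (by linarith : -α 2 - ζ ≤ 0),
      posPart_eq_zero.2 (by linarith : -α 5 - ζ ≤ 0),
      posPart_eq_self.2 (by linarith : 0 ≤ ζ - α 5),
      posPart_eq_zero.2 (by linarith : α 5 + ζ - 1 ≤ 0)]
    linarith [hcoef (ζ ^ 2), hcoef (z ^ 2)]
end

section
/- Let α ∈ ℝ⁶ and ζ ∈ ℝ satisfy α₁ ≥ α₂ ≥ α₃ ≥ α₄ ≥ α₅ ≥ α₆ ≥ −ζ, 0 ≤ ζ ≤ α₄ + α₅ + α₆, and α₁ + ⋯ + α₆ = 1. Then fob(α, ζ) = 4ζ² + E − Σ_{r : α_r < ζ} (α_r − ζ)², where E = (α₅ + α₆)² if α₅ + α₆ < 0 and E = 0 otherwise. -/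
theorem g_fract_of_mem_Icc {x : ℝ} (h0 : 0 ≤ x) (h1 : x ≤ 1) : g (Int.fract x) = g x := by
  rcases h1.lt_or_eq with h | rfl
  · rw [Int.fract_eq_self.2 ⟨h0, h⟩]
  · simp [g]

theorem g_fract_of_abs_le_one {x : ℝ} (h0 : -1 ≤ x) (h1 : x ≤ 1) :
    g (Int.fract x) = g x + if x < 0 then x ^ 2 else 0 := by
  split_ifs with h
  · rw [← Int.fract_add_one x, g_fract_of_mem_Icc (by linarith) (by linarith)]
    unfold g
    ring
  · rw [g_fract_of_mem_Icc (not_lt.1 h) h1, add_zero]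

/-- Explicit quadratic form of `fob` on the fundamental domain of the extended
affine Weyl group action:
`fob(α,ζ) = 4ζ² + E − Σ_{r : α_r < ζ} (α_r − ζ)²` with
`E = (α₅+α₆)²` if `α₅+α₆ < 0` and `E = 0` otherwise. -/
theorem fob_on_fundamental_domain
    (α : Fin 6 → ℝ) (ζ : ℝ)
    (h01 : α 1 ≤ α 0) (h12 : α 2 ≤ α 1) (h23 : α 3 ≤ α 2)
    (h34 : α 4 ≤ α 3) (h45 : α 5 ≤ α 4) (h5ζ : -ζ ≤ α 5)
    (hζ0 : 0 ≤ ζ) (hζ1 : ζ ≤ α 3 + α 4 + α 5)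
    (hsum : ∑ r, α r = 1) :
    fob α ζ = 4 * ζ ^ 2 + (if α 4 + α 5 < 0 then (α 4 + α 5) ^ 2 else 0)
      - ∑ r : Fin 6, (if α r < ζ then (α r - ζ) ^ 2 else 0) := by
  simp only [Fin.sum_univ_six] at hsum
  have h2 : 0 ≤ α 2 := by linarith
  have h35 : 0 ≤ α 3 + α 5 := by
    rcases le_total (α 4) ζ with h | h <;> linarith
  have hsub (r : Fin 6) (hl : α 5 ≤ α r) (hu : α r ≤ α 0) :
      g (Int.fract (α r - ζ)) = g (α r - ζ) + if α r < ζ then (α r - ζ) ^ 2 else 0 := by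
    simpa only [sub_neg] using
      g_fract_of_abs_le_one (x := α r - ζ) (by linarith) (by linarith)
  have hadd (r : Fin 6) (hl : α 5 ≤ α r) (hu : α r ≤ α 0) :
      g (Int.fract (α r + ζ)) = g (α r + ζ) :=
    g_fract_of_mem_Icc (by linarith) (by linarith)
  have hpair (r s : Fin 6) (hl : 0 ≤ α r + α s) (hu : α r + α s ≤ α 0 + α 1) :
      g (Int.fract (α r + α s)) = g (α r + α s) :=
    g_fract_of_mem_Icc hl (by linarith)
  have h45' := g_fract_of_abs_le_one (x := α 4 + α 5) (by linarith) (by linarith)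
  have h0 : α 0 = 1 - α 1 - α 2 - α 3 - α 4 - α 5 := by linarith
  simp only [fob, Fin.sum_univ_six, Fin.reduceLT, if_true, if_false]
  rw [h45']
  rw [hpair 0 1 (by linarith) (by linarith),
    hpair 0 2 (by linarith) (by linarith),
    hpair 0 3 (by linarith) (by linarith),
    hpair 0 4 (by linarith) (by linarith),
    hpair 0 5 (by linarith) (by linarith),
    hpair 1 2 (by linarith) (by linarith),
    hpair 1 3 (by linarith) (by linarith),
    hpair 1 4 (by linarith) (by linarith),
    hpair 1 5 (by linarith) (by linarith),
    hpair 2 3 (by linarith) (by linarith),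
    hpair 2 4 (by linarith) (by linarith),
    hpair 2 5 (by linarith) (by linarith),
    hpair 3 4 (by linarith) (by linarith),
    hpair 3 5 (by linarith) (by linarith)]
  rw [hsub 0 (by linarith) (by linarith), hadd 0 (by linarith) (by linarith),
    hsub 1 (by linarith) (by linarith), hadd 1 (by linarith) (by linarith),
    hsub 2 (by linarith) (by linarith), hadd 2 (by linarith) (by linarith),
    hsub 3 (by linarith) (by linarith), hadd 3 (by linarith) (by linarith),
    hsub 4 (by linarith) (by linarith), hadd 4 (by linarith) (by linarith),
    hsub 5 (by linarith) (by linarith), hadd 5 (by linarith) (by linarith)]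
  simp only [g]
  generalize (if α 4 + α 5 < 0 then (α 4 + α 5) ^ 2 else 0) = E
  rw [h0]
  ring
end

section
/- Let α ∈ ℝ⁶ and ζ ∈ ℝ satisfy α₁ ≥ α₂ ≥ α₃ ≥ α₄ ≥ α₅ ≥ α₆ ≥ α₁ − 1, 0 ≤ ζ ≤ 1/2, and α₁ + ⋯ + α₆ = 1. Then fob(α, ζ) = 0 if and only if at least one of the following fourteen conditions holds: (1) ζ = −α₆, α₁ + α₂ ≤ 1 and α₄ + α₅ ≥ 0; (2) ζ = α₃, α₁ + α₂ ≥ 1 and α₄ + α₅ ≤ 0; (3) α₄ + α₅ = 0, ζ ≤ α₃ and α₆ + ζ ≤ 0; (4) α₁ + α₂ = 1, ζ ≥ α₃ and α₆ + ζ ≥ 0; (5) ζ = 0 and α₆ ≥ 0; (6) α₃ = α₄, ζ ≤ α₃ and α₄ + α₅ ≤ 0; (7) α₁ = α₆ + 1, ζ ≥ −α₆ and α₁ + α₂ ≤ 1; (8) ζ = 1/2 and α₃ ≥ 1/2; (9) ζ = −(α₄ + α₅ + α₆), α₄ + α₅ ≤ 0 and α₁ + α₂ ≤ 1; (10) ζ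 = 0 and α₃ ≤ 0; (11) ζ = 1/2 and α₆ ≤ −1/2; (12) ζ = α₃ + α₄ + α₅, α₁ + α₂ ≥ 1 and α₄ + α₅ ≥ 0; (13) α₂ = α₃, ζ ≥ α₃ and α₁ + α₂ ≥ 1; (14) α₅ = α₆, α₄ + α₅ ≥ 0 and α₆ + ζ ≤ 0. -/
/-- The `1`-periodic extension of `g` from `[0, 1)`. -/
noncomputable def periodicG (x : ℝ) : ℝ := g (Int.fract x)

lemma periodicG_add_intCast (x : ℝ) (n : ℤ) : periodicG (x + n) = periodicG x := by
  simp [periodicG]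

lemma periodicG_neg (x : ℝ) : periodicG (-x) = -periodicG x := by
  unfold periodicG
  by_cases h : Int.fract x = 0
  · rw [Int.fract_neg_eq_zero.2 h, h]
    simp [g]
  · rw [Int.fract_neg h]
    unfold g
    ring

lemma sum_lt_eq_half_sum_sub_diag (F : Fin 6 → Fin 6 → ℝ) (hF : ∀ r s, F r s = F s r) :
    (∑ r : Fin 6, ∑ s : Fin 6, if r < s then F r s else 0)
      = (∑ r, ∑ s, F r s - ∑ r, F r r) / 2 := by
  have h : ∀ r s, F r s = (if r < s then F r s else 0) + (if s < r then F s r else 0)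
      + (if r = s then F r r else 0) := by
    intro r s
    rcases lt_trichotomy r s with h | h | h
    · simp [h, h.not_gt, h.ne]
    · simp [h]
    · simp [h, h.not_gt, h.ne', hF r s]
  have h₁ : ∑ r, ∑ s, F r s = (∑ r : Fin 6, ∑ s : Fin 6, if r < s then F r s else 0)
      + (∑ r : Fin 6, ∑ s : Fin 6, if s < r then F s r else 0) + ∑ r, F r r := by
    rw [Finset.sum_congr rfl fun r _ => Finset.sum_congr rfl fun s _ => h r s]
    simp [Finset.sum_add_distrib]
  rw [Finset.sum_comm (f := fun r s : Fin 6 => if s < r then F s r else 0)] at h₁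
  linarith

lemma fob_eq_half (α : Fin 6 → ℝ) (ζ : ℝ) :
    fob α ζ = (∑ r, ∑ s, periodicG (α r + α s) - ∑ r, periodicG (α r + α r)) / 2
      - ∑ r, (periodicG (α r - ζ) + periodicG (α r + ζ)) := by
  rw [← sum_lt_eq_half_sum_sub_diag (fun r s => periodicG (α r + α s))
    fun r s => by rw [add_comm]]
  rfl

lemma fob_comp_perm (α : Fin 6 → ℝ) (ζ : ℝ) (σ : Equiv.Perm (Fin 6)) :
    fob (fun r => α (σ r)) ζ = fob α ζ := by
  simp only [fob_eq_half]
  rw [Equiv.sum_comp σ fun r => ∑ s, periodicG (α r + α (σ s)),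
    Equiv.sum_comp σ fun r => periodicG (α r + α r),
    Equiv.sum_comp σ fun r => periodicG (α r - ζ) + periodicG (α r + ζ),
    Finset.sum_congr rfl fun r _ => Equiv.sum_comp σ fun s => periodicG (α r + α s)]

lemma fob_add_intCast (α : Fin 6 → ℝ) (ζ : ℝ) (n : Fin 6 → ℤ) :
    fob (fun r => α r + n r) ζ = fob α ζ := by
  have h₁ : ∀ r s, periodicG (α r + n r + (α s + n s)) = periodicG (α r + α s) := fun r s => by
    rw [← periodicG_add_intCast (α r + α s) (n r + n s)]
    push_cast
    ring_nf
  have h₂ : ∀ r, periodicG (α r + n r - ζ) = periodicG (α r - ζ) := fun r => by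
    rw [← periodicG_add_intCast (α r - ζ) (n r)]
    ring_nf
  have h₃ : ∀ r, periodicG (α r + n r + ζ) = periodicG (α r + ζ) := fun r => by
    rw [← periodicG_add_intCast (α r + ζ) (n r)]
    ring_nf
  simp only [fob_eq_half, h₁, h₂, h₃]

lemma fob_neg (α : Fin 6 → ℝ) (ζ : ℝ) : fob (fun r => -α r) ζ = -fob α ζ := by
  have h₁ : ∀ r s, periodicG (-α r + -α s) = -periodicG (α r + α s) := fun r s => by
    rw [← periodicG_neg]
    ring_nf
  have h₂ : ∀ r, periodicG (-α r - ζ) = -periodicG (α r + ζ) := fun r => by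
    rw [← periodicG_neg]
    ring_nf
  have h₃ : ∀ r, periodicG (-α r + ζ) = -periodicG (α r - ζ) := fun r => by
    rw [← periodicG_neg]
    ring_nf
  simp only [fob_eq_half, h₁, h₂, h₃, Finset.sum_neg_distrib, Finset.sum_add_distrib]
  ring

lemma fob_half_add (α : Fin 6 → ℝ) (ζ : ℝ) : fob (fun r => 1 / 2 + α r) (1 / 2 - ζ) = fob α ζ := by
  have h₁ : ∀ r s, periodicG (1 / 2 + α r + (1 / 2 + α s)) = periodicG (α r + α s) := fun r s => by
    rw [← periodicG_add_intCast (α r + α s) 1]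
    push_cast
    ring_nf
  have h₂ : ∀ r, periodicG (1 / 2 + α r - (1 / 2 - ζ)) = periodicG (α r + ζ) := fun r => by
    ring_nf
  have h₃ : ∀ r, periodicG (1 / 2 + α r + (1 / 2 - ζ)) = periodicG (α r - ζ) := fun r => by
    rw [← periodicG_add_intCast (α r - ζ) 1]
    push_cast
    ring_nf
  simp only [fob_eq_half, h₁, h₂, h₃, add_comm (periodicG (_ + ζ))]

/-- Half-period reflection, rearranged into the fundamental domain. -/
noncomputable def reflect (α : Fin 6 → ℝ) : Fin 6 → ℝ :=
  ![1 / 2 - α 4, 1 / 2 - α 3, 1 / 2 - α 2, 1 / 2 - α 1, 1 / 2 - α 0, -(1 / 2) - α 5]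

/-- Half-period translation, rearranged into the fundamental domain. -/
noncomputable def halfShift (α : Fin 6 → ℝ) : Fin 6 → ℝ :=
  ![α 3 + 1 / 2, α 4 + 1 / 2, α 5 + 1 / 2, α 0 - 1 / 2, α 1 - 1 / 2, α 2 - 1 / 2]

lemma fob_halfShift (α : Fin 6 → ℝ) (ζ : ℝ) : fob (halfShift α) (1 / 2 - ζ) = fob α ζ := by
  rw [← fob_half_add α, ← fob_comp_perm (fun r => 1 / 2 + α r) _ (Equiv.addRight 3),
    ← fob_add_intCast (fun r => 1 / 2 + α (Equiv.addRight 3 r)) _ ![0, 0, 0, -1, -1, -1]]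
  congr 1
  funext r
  fin_cases r <;> simp [halfShift] <;> ring

lemma fob_reflect (α : Fin 6 → ℝ) (ζ : ℝ) : fob (reflect α) (1 / 2 - ζ) = -fob α ζ := by
  rw [← fob_neg, ← fob_half_add (fun r => -α r),
    ← fob_comp_perm (fun r => 1 / 2 + -α r) _ (Equiv.subLeft 4),
    ← fob_add_intCast (fun r => 1 / 2 + -α (Equiv.subLeft 4 r)) _ ![0, 0, 0, 0, 0, -1]]
  congr 1
  funext r
  fin_cases r <;> simp [reflect] <;> ring

/-- The square of the positive part. -/
noncomputable def posSq (x : ℝ) : ℝ := max x 0 ^ 2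

lemma posSq_of_nonneg {x : ℝ} (h : 0 ≤ x) : posSq x = x ^ 2 := by simp [posSq, h]

lemma posSq_of_nonpos {x : ℝ} (h : x ≤ 0) : posSq x = 0 := by simp [posSq, h]

lemma posSq_nonneg (x : ℝ) : 0 ≤ posSq x := sq_nonneg _

/-- The difference between the periodic extension of `g` and `g` on `[-2, 2]`. -/
noncomputable def correction (x : ℝ) : ℝ := posSq (-x) + posSq (-x - 1) - posSq (x - 1)

lemma periodicG_eq {x : ℝ} (h₀ : -2 ≤ x) (h₁ : x < 2) : periodicG x = g x + correction x := by
  have key : ∀ n : ℤ, (n : ℝ) ≤ x → x < n + 1 → Int.fract x = x - n := fun n hn hn' => by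
    rw [Int.fract, Int.floor_eq_iff.2 ⟨hn, hn'⟩]
  unfold periodicG correction
  rcases lt_or_ge x (-1) with h | h
  · rw [key (-2) (by push_cast; linarith) (by push_cast; linarith),
      posSq_of_nonneg (by linarith), posSq_of_nonneg (by linarith), posSq_of_nonpos (by linarith)]
    unfold g
    push_cast
    ring
  rcases lt_or_ge x 0 with h | h
  · rw [key (-1) (by push_cast; linarith) (by push_cast; linarith),
      posSq_of_nonneg (by linarith), posSq_of_nonpos (by linarith), posSq_of_nonpos (by linarith)]
    unfold g
    push_cast
    ring
  rcases lt_or_ge x 1 with h | h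
  · rw [key 0 (by push_cast; linarith) (by push_cast; linarith),
      posSq_of_nonpos (by linarith), posSq_of_nonpos (by linarith), posSq_of_nonpos (by linarith)]
    unfold g
    push_cast
    ring
  · rw [key 1 (by push_cast; linarith) (by push_cast; linarith),
      posSq_of_nonpos (by linarith), posSq_of_nonpos (by linarith), posSq_of_nonneg (by linarith)]
    unfold g
    push_cast
    ring

lemma correction_of_mem_unit {x : ℝ} (h₀ : 0 ≤ x) (h₁ : x ≤ 1) : correction x = 0 := by
  rw [correction, posSq_of_nonpos (by linarith), posSq_of_nonpos (by linarith),
    posSq_of_nonpos (by linarith)]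
  ring

lemma correction_of_abs_le_one {x : ℝ} (h₀ : -1 ≤ x) (h₁ : x ≤ 1) :
    correction x = posSq (-x) := by
  rw [correction, posSq_of_nonpos (x := -x - 1) (by linarith),
    posSq_of_nonpos (x := x - 1) (by linarith)]
  ring

lemma correction_of_le_one {x : ℝ} (h : x ≤ 1) :
    correction x = posSq (-x) + posSq (-x - 1) := by
  rw [correction, posSq_of_nonpos (x := x - 1) (by linarith)]
  ring

/-- The fundamental domain of the translation-and-permutation action. -/
structure FundamentalDomain (α : Fin 6 → ℝ) (ζ : ℝ) : Prop where
  h01 : α 1 ≤ α 0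
  h12 : α 2 ≤ α 1
  h23 : α 3 ≤ α 2
  h34 : α 4 ≤ α 3
  h45 : α 5 ≤ α 4
  h50 : α 0 - 1 ≤ α 5
  zeta_nonneg : 0 ≤ ζ
  zeta_le : ζ ≤ 1 / 2
  sum_eq : α 0 + α 1 + α 2 + α 3 + α 4 + α 5 = 1

lemma FundamentalDomain.halfShift {α : Fin 6 → ℝ} {ζ : ℝ} (h : FundamentalDomain α ζ) :
    FundamentalDomain (halfShift α) (1 / 2 - ζ) := by
  obtain ⟨h01, h12, h23, h34, h45, h50, hζ0, hζ1, hs⟩ := h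
  constructor <;> simp [_root_.halfShift] <;> linarith

lemma FundamentalDomain.reflect {α : Fin 6 → ℝ} {ζ : ℝ} (h : FundamentalDomain α ζ) :
    FundamentalDomain (reflect α) (1 / 2 - ζ) := by
  obtain ⟨h01, h12, h23, h34, h45, h50, hζ0, hζ1, hs⟩ := h
  constructor <;> simp [_root_.reflect] <;> linarith

lemma fob_eq_sum_correction {α : Fin 6 → ℝ} {ζ : ℝ} (h : FundamentalDomain α ζ) :
    fob α ζ = 4 * ζ ^ 2
      + (correction (α 0 + α 1) + correction (α 0 + α 2) + correction (α 0 + α 3)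
        + correction (α 0 + α 4) + correction (α 0 + α 5) + correction (α 1 + α 2)
        + correction (α 1 + α 3) + correction (α 1 + α 4) + correction (α 1 + α 5)
        + correction (α 2 + α 3) + correction (α 2 + α 4) + correction (α 2 + α 5)
        + correction (α 3 + α 4) + correction (α 3 + α 5) + correction (α 4 + α 5))
      - (correction (α 0 - ζ) + correction (α 1 - ζ) + correction (α 2 - ζ)
        + correction (α 3 - ζ) + correction (α 4 - ζ) + correction (α 5 - ζ))
      - (correction (α 0 + ζ) + correction (α 1 + ζ) + correction (α 2 + ζ)
        + correction (α 3 + ζ) + correction (α 4 + ζ) + correction (α 5 + ζ)) := by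
  obtain ⟨h01, h12, h23, h34, h45, h50, hζ0, hζ1, hs⟩ := h
  have e : fob α ζ = (∑ r : Fin 6, ∑ s : Fin 6, if r < s then periodicG (α r + α s) else 0)
    - ∑ r : Fin 6, (periodicG (α r - ζ) + periodicG (α r + ζ)) := rfl
  rw [e]
  simp [Fin.sum_univ_six]
  repeat rw [periodicG_eq (by linarith) (by linarith)]
  have h5 : α 5 = 1 - (α 0 + α 1 + α 2 + α 3 + α 4) := by linarith
  unfold g
  rw [h5]
  ring

/-- The union of the fourteen polytopal pieces. -/
def ZeroPieces (α : Fin 6 → ℝ) (ζ : ℝ) : Prop :=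
  (ζ = -α 5 ∧ α 0 + α 1 ≤ 1 ∧ 0 ≤ α 3 + α 4) ∨
  (ζ = α 2 ∧ 1 ≤ α 0 + α 1 ∧ α 3 + α 4 ≤ 0) ∨
  (α 3 + α 4 = 0 ∧ ζ ≤ α 2 ∧ α 5 + ζ ≤ 0) ∨
  (α 0 + α 1 = 1 ∧ α 2 ≤ ζ ∧ 0 ≤ α 5 + ζ) ∨
  (ζ = 0 ∧ 0 ≤ α 5) ∨
  (α 2 = α 3 ∧ ζ ≤ α 2 ∧ α 3 + α 4 ≤ 0) ∨
  (α 0 = α 5 + 1 ∧ -α 5 ≤ ζ ∧ α 0 + α 1 ≤ 1) ∨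
  (ζ = 1 / 2 ∧ 1 / 2 ≤ α 2) ∨
  (ζ = -(α 3 + α 4 + α 5) ∧ α 3 + α 4 ≤ 0 ∧ α 0 + α 1 ≤ 1) ∨
  (ζ = 0 ∧ α 2 ≤ 0) ∨
  (ζ = 1 / 2 ∧ α 5 ≤ -(1 / 2)) ∨
  (ζ = α 2 + α 3 + α 4 ∧ 1 ≤ α 0 + α 1 ∧ 0 ≤ α 3 + α 4) ∨
  (α 1 = α 2 ∧ α 2 ≤ ζ ∧ 1 ≤ α 0 + α 1) ∨
  (α 4 = α 5 ∧ 0 ≤ α 3 + α 4 ∧ α 5 + ζ ≤ 0)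

lemma ZeroPieces.halfShift {α : Fin 6 → ℝ} {ζ : ℝ} (hs : α 0 + α 1 + α 2 + α 3 + α 4 + α 5 = 1)
    (h : ZeroPieces α ζ) : ZeroPieces (halfShift α) (1 / 2 - ζ) := by
  simp only [ZeroPieces, _root_.halfShift, Matrix.cons_val]
  obtain h | h | h | h | h | h | h | h | h | h | h | h | h | h := h
  · iterate 1 right
    left
    refine ⟨?_, ?_, ?_⟩ <;> linarith
  · left
    refine ⟨?_, ?_, ?_⟩ <;> linarith
  · iterate 3 right
    left
    refine ⟨?_, ?_, ?_⟩ <;> linarith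
  · iterate 2 right
    left
    refine ⟨?_, ?_, ?_⟩ <;> linarith
  · iterate 7 right
    left
    refine ⟨?_, ?_⟩ <;> linarith
  · iterate 6 right
    left
    refine ⟨?_, ?_, ?_⟩ <;> linarith
  · iterate 5 right
    left
    refine ⟨?_, ?_, ?_⟩ <;> linarith
  · iterate 4 right
    left
    refine ⟨?_, ?_⟩ <;> linarith
  · iterate 8 right
    left
    refine ⟨?_, ?_, ?_⟩ <;> linarith
  · iterate 10 right
    left
    refine ⟨?_, ?_⟩ <;> linarith
  · iterate 9 right
    left
    refine ⟨?_, ?_⟩ <;> linarith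
  · iterate 11 right
    left
    refine ⟨?_, ?_, ?_⟩ <;> linarith
  · iterate 13 right
    refine ⟨?_, ?_, ?_⟩ <;> linarith
  · iterate 12 right
    left
    refine ⟨?_, ?_, ?_⟩ <;> linarith

lemma ZeroPieces.reflect {α : Fin 6 → ℝ} {ζ : ℝ} (hs : α 0 + α 1 + α 2 + α 3 + α 4 + α 5 = 1)
    (h : ZeroPieces α ζ) : ZeroPieces (reflect α) (1 / 2 - ζ) := by
  simp only [ZeroPieces, _root_.reflect, Matrix.cons_val]
  obtain h | h | h | h | h | h | h | h | h | h | h | h | h | h := h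
  · left
    refine ⟨?_, ?_, ?_⟩ <;> linarith
  · iterate 1 right
    left
    refine ⟨?_, ?_, ?_⟩ <;> linarith
  · iterate 3 right
    left
    refine ⟨?_, ?_, ?_⟩ <;> linarith
  · iterate 2 right
    left
    refine ⟨?_, ?_, ?_⟩ <;> linarith
  · iterate 10 right
    left
    refine ⟨?_, ?_⟩ <;> linarith
  · iterate 12 right
    left
    refine ⟨?_, ?_, ?_⟩ <;> linarith
  · iterate 13 right
    refine ⟨?_, ?_, ?_⟩ <;> linarith
  · iterate 9 right
    left
    refine ⟨?_, ?_⟩ <;> linarith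
  · iterate 11 right
    left
    refine ⟨?_, ?_, ?_⟩ <;> linarith
  · iterate 7 right
    left
    refine ⟨?_, ?_⟩ <;> linarith
  · iterate 4 right
    left
    refine ⟨?_, ?_⟩ <;> linarith
  · iterate 8 right
    left
    refine ⟨?_, ?_, ?_⟩ <;> linarith
  · iterate 5 right
    left
    refine ⟨?_, ?_, ?_⟩ <;> linarith
  · iterate 6 right
    left
    refine ⟨?_, ?_, ?_⟩ <;> linarith

/-- The classification at a single point. -/
def Classified (α : Fin 6 → ℝ) (ζ : ℝ) : Prop := fob α ζ = 0 ↔ ZeroPieces α ζ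

lemma halfShift_halfShift (α : Fin 6 → ℝ) : halfShift (halfShift α) = α := by
  funext r
  fin_cases r <;> simp [halfShift]

lemma reflect_reflect (α : Fin 6 → ℝ) : reflect (reflect α) = α := by
  funext r
  fin_cases r <;> simp [reflect]

lemma Classified.of_halfShift {α : Fin 6 → ℝ} {ζ : ℝ} (h : FundamentalDomain α ζ)
    (hc : Classified (halfShift α) (1 / 2 - ζ)) : Classified α ζ := by
  have hz : ZeroPieces (halfShift α) (1 / 2 - ζ) ↔ ZeroPieces α ζ :=
    ⟨fun hp => by simpa [halfShift_halfShift] using hp.halfShift h.halfShift.sum_eq,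
      fun hp => hp.halfShift h.sum_eq⟩
  rwa [Classified, fob_halfShift, hz] at hc

lemma Classified.of_reflect {α : Fin 6 → ℝ} {ζ : ℝ} (h : FundamentalDomain α ζ)
    (hc : Classified (reflect α) (1 / 2 - ζ)) : Classified α ζ := by
  have hz : ZeroPieces (reflect α) (1 / 2 - ζ) ↔ ZeroPieces α ζ :=
    ⟨fun hp => by simpa [reflect_reflect] using hp.reflect h.reflect.sum_eq,
      fun hp => hp.reflect h.sum_eq⟩
  rwa [Classified, fob_reflect, hz, neg_eq_zero] at hc

/-- Where `α 0 + α 1 ≤ 1`, `α 3 + α 4 ≤ 0`, `-α 5 ≤ ζ ≤ α 2`, `fob` is a perfect square. -/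
lemma fob_eq_sq {α : Fin 6 → ℝ} {ζ : ℝ} (h : FundamentalDomain α ζ) (hA : α 0 + α 1 ≤ 1)
    (hB : α 3 + α 4 ≤ 0) (hC : 0 ≤ α 5 + ζ) (hD : ζ ≤ α 2) :
    fob α ζ = (ζ + α 3 + α 4 + α 5) ^ 2 := by
  rw [fob_eq_sum_correction h]
  obtain ⟨h01, h12, h23, h34, h45, h50, hζ0, hζ1, hs⟩ := h
  simp (disch := grind) only [correction_of_mem_unit]
  simp (disch := grind) only [correction_of_abs_le_one, posSq_of_nonneg]
  ring

lemma classified_of_zeta_between {α : Fin 6 → ℝ} {ζ : ℝ} (h : FundamentalDomain α ζ)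
    (hA : α 0 + α 1 ≤ 1) (hB : α 3 + α 4 ≤ 0) (hC : 0 ≤ α 5 + ζ) (hD : ζ ≤ α 2) :
    Classified α ζ := by
  rw [Classified, fob_eq_sq h hA hB hC hD, sq_eq_zero_iff]
  obtain ⟨h01, h12, h23, h34, h45, h50, hζ0, hζ1, hs⟩ := h
  constructor
  · intro h0
    iterate 8 right
    left
    refine ⟨?_, ?_, ?_⟩ <;> linarith
  · rintro (h | h | h | h | h | h | h | h | h | h | h | h | h | h) <;> linarith

lemma fob_eq_of_zeta_le {α : Fin 6 → ℝ} {ζ : ℝ} (h : FundamentalDomain α ζ)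
    (hA : α 0 + α 1 ≤ 1) (hB : α 3 + α 4 ≤ 0) (hC : α 5 + ζ ≤ 0) :
    fob α ζ = 2 * (α 3 + α 4) * α 5 + 2 * α 3 * α 4 - 2 * ζ ^ 2
      + posSq (ζ + α 3) + posSq (α 3 - ζ) + posSq (ζ + α 4) := by
  rw [fob_eq_sum_correction h]
  obtain ⟨h01, h12, h23, h34, h45, h50, hζ0, hζ1, hs⟩ := h
  simp (disch := grind) only [correction_of_mem_unit]
  simp (disch := grind) only [correction_of_abs_le_one, posSq_of_nonneg]
  have reflect_sq : ∀ x, posSq x = x ^ 2 - posSq (-x) := fun x => by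
    rcases le_total 0 x with hx | hx
    · rw [posSq_of_nonneg hx, posSq_of_nonpos (by linarith)]
      ring
    · rw [posSq_of_nonneg (x := -x) (by linarith), posSq_of_nonpos hx]
      ring
  rw [reflect_sq (-(α 3 - ζ)), reflect_sq (-(α 3 + ζ)), reflect_sq (-(α 4 + ζ))]
  ring_nf

lemma classified_of_zeta_le {α : Fin 6 → ℝ} {ζ : ℝ} (h : FundamentalDomain α ζ)
    (hA : α 0 + α 1 ≤ 1) (hB : α 3 + α 4 ≤ 0) (hC : α 5 + ζ ≤ 0) : Classified α ζ := by
  rw [Classified, fob_eq_of_zeta_le h hA hB hC]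
  obtain ⟨h01, h12, h23, h34, h45, h50, hζ0, hζ1, hs⟩ := h
  rcases hB.eq_or_lt with h0 | hB
  · refine iff_of_true ?_ (Or.inr <| Or.inr <| Or.inl ⟨h0, by linarith, hC⟩)
    obtain h4 : α 4 = -α 3 := by linarith
    rw [h4, posSq_of_nonneg (by linarith)]
    rcases le_total (α 3) ζ with h | h
    · rw [posSq_of_nonpos (x := α 3 - ζ) (by linarith), posSq_of_nonneg (by linarith)]
      ring
    · rw [posSq_of_nonpos (x := ζ + -α 3) (by linarith), posSq_of_nonneg (by linarith)]
      ring
  · refine iff_of_false (ne_of_gt ?_) ?_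
    · generalize ha : α 3 = a at *
      generalize hb : α 4 = b at *
      generalize hc : α 5 = c at *
      rcases le_total 0 (ζ + b) with hb' | hb'
      · rw [posSq_of_nonneg hb']
        rcases le_total 0 (ζ + a) with ha' | ha'
        · rw [posSq_of_nonneg ha', posSq_of_nonpos (by linarith)]
          nlinarith [mul_nonneg (sub_nonneg.2 hB.le) (sub_nonneg.2 hC), mul_pos_of_neg_of_neg hB hB]
        · obtain rfl : a = -ζ := by linarith
          obtain rfl : b = -ζ := by linarith
          rw [posSq_of_nonpos ha', posSq_of_nonpos (by linarith)]
          nlinarith [mul_pos_of_neg_of_neg hB (show c < 0 by linarith)]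
      · rw [posSq_of_nonpos hb']
        rcases le_total 0 (ζ + a) with ha' | ha'
        · rw [posSq_of_nonneg ha']
          rcases le_total a ζ with ha'' | ha''
          · rw [posSq_of_nonpos (by linarith)]
            nlinarith [mul_nonneg (sub_nonneg.2 hB.le) (sub_nonneg.2 h45), mul_nonneg (sub_nonneg.2 hb') (sub_nonneg.2 ha'')]
          · rw [posSq_of_nonneg (by linarith)]
            nlinarith [mul_pos_of_neg_of_neg hB hB, mul_nonneg (sub_nonneg.2 hB.le) (sub_nonneg.2 h45)]
        · rw [posSq_of_nonpos ha', posSq_of_nonpos (by linarith)]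
          nlinarith [mul_pos_of_neg_of_neg hB (show c < 0 by linarith)]
    · rintro (h | h | h | h | h | h | h | h | h | h | h | h | h | h) <;> linarith

/-- The contribution to `fob` of a coordinate `x ≥ -u`, where `-u` is the smallest coordinate. -/
noncomputable def profile (u ζ x : ℝ) : ℝ := posSq (u - x) - posSq (ζ - x) - posSq (-ζ - x)

section profile

variable {u ζ x y w : ℝ}

lemma profile_of_le (h : ζ ≤ u) (hu : 0 ≤ ζ) (hx : u ≤ x) : profile u ζ x = 0 := by
  rw [profile, posSq_of_nonpos (by linarith), posSq_of_nonpos (by linarith),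
    posSq_of_nonpos (by linarith)]
  ring

lemma profile_of_mem_Icc (hx : ζ ≤ x) (hu : x ≤ u) (hζ : 0 ≤ ζ) :
    profile u ζ x = (u - x) ^ 2 := by
  rw [profile, posSq_of_nonneg (by linarith), posSq_of_nonpos (by linarith),
    posSq_of_nonpos (by linarith)]
  ring

lemma profile_of_abs_le (h : ζ ≤ u) (h₀ : -ζ ≤ x) (h₁ : x ≤ ζ) :
    profile u ζ x = u ^ 2 - ζ ^ 2 - 2 * (u - ζ) * x := by
  rw [profile, posSq_of_nonneg (by linarith), posSq_of_nonneg (by linarith),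
    posSq_of_nonpos (by linarith)]
  ring

lemma profile_of_le_neg (h : ζ ≤ u) (hζ : 0 ≤ ζ) (hx : x ≤ -ζ) :
    profile u ζ x = 2 * (u ^ 2 - ζ ^ 2) - (u + x) ^ 2 := by
  rw [profile, posSq_of_nonneg (by linarith), posSq_of_nonneg (by linarith),
    posSq_of_nonneg (by linarith)]
  ring

lemma profile_add_profile_neg (h : ζ ≤ u) (hζ : 0 ≤ ζ) (h₀ : -u ≤ x) (h₁ : x ≤ u) :
    profile u ζ x + profile u ζ (-x) = 2 * (u ^ 2 - ζ ^ 2) := by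
  rcases le_total x ζ with hx | hx
  · rcases le_total (-ζ) x with hx' | hx'
    · rw [profile_of_abs_le h hx' hx, profile_of_abs_le h (by linarith) (by linarith)]
      ring
    · rw [profile_of_le_neg h hζ hx', profile_of_mem_Icc (by linarith) (by linarith) hζ]
      ring
  · rw [profile_of_mem_Icc hx h₁ hζ, profile_of_le_neg h hζ (by linarith)]
    ring

/-- Strict convexity of `profile` along chords ending at `u`. -/
lemma profile_chord_lt (h : ζ < u) (hζ : 0 ≤ ζ) (h₀ : 0 ≤ y) (h₁ : y < x) (h₂ : x < u) :
    profile u ζ x * (u - y) < profile u ζ y * (u - x) := by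
  have hp := mul_pos (sub_pos.2 h₁) (sub_pos.2 h₂)
  rcases le_total ζ x with hx | hx
  · rw [profile_of_mem_Icc hx h₂.le hζ]
    rcases le_total ζ y with hy | hy
    · rw [profile_of_mem_Icc hy (by linarith) hζ]
      nlinarith [mul_pos hp (show 0 < u - y by linarith)]
    · rw [profile_of_abs_le h.le (by linarith) hy]
      have : 0 < (u - ζ) * (u + ζ - 2 * y) - (u - x) * (u - y) := by
        rcases hy.eq_or_lt with rfl | hy
        · nlinarith [mul_pos (sub_pos.2 h) (sub_pos.2 h₁)]
        · nlinarith [mul_pos (sub_pos.2 h) (sub_pos.2 hy),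
            mul_nonneg (sub_nonneg.2 hx) (show 0 ≤ u - y by linarith)]
      nlinarith [mul_pos this (sub_pos.2 h₂)]
  · rw [profile_of_abs_le h.le (by linarith) hx, profile_of_abs_le h.le (by linarith) (by linarith)]
    nlinarith [mul_pos (mul_pos (sub_pos.2 h₁) (sub_pos.2 h)) (sub_pos.2 h)]

lemma profile_chord_le (h : ζ < u) (hζ : 0 ≤ ζ) (h₀ : 0 ≤ y) (h₁ : y ≤ x) (h₂ : x ≤ u) :
    profile u ζ x * (u - y) ≤ profile u ζ y * (u - x) := by
  rcases h₁.eq_or_lt with rfl | h₁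
  · exact le_rfl
  rcases h₂.eq_or_lt with rfl | h₂
  · rw [profile_of_le h.le hζ le_rfl]
    simp
  exact (profile_chord_lt h hζ h₀ h₁ h₂).le

/-- Convexity of `profile` along chords starting at `y` and ending at or after `ζ`. -/
lemma profile_chord_le_of_zeta_le (h : ζ < u) (hζ : 0 ≤ ζ) (h₀ : 0 ≤ y) (h₁ : y ≤ x)
    (h₂ : x ≤ w) (hw : ζ ≤ w) (hu : w ≤ u) :
    profile u ζ x * (w - y) ≤ profile u ζ y * (w - x) + profile u ζ w * (x - y) := by
  have hp := mul_nonneg (sub_nonneg.2 h₁) (sub_nonneg.2 h₂)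
  rw [profile_of_mem_Icc hw hu hζ]
  rcases le_total ζ x with hx | hx
  · rw [profile_of_mem_Icc hx (by linarith) hζ]
    rcases le_total ζ y with hy | hy
    · rw [profile_of_mem_Icc hy (by linarith) hζ]
      nlinarith [mul_nonneg hp (show 0 ≤ w - y by linarith)]
    · rw [profile_of_abs_le h.le (by linarith) hy]
      have : 0 ≤ (x - y) * (w - y) - (ζ - y) ^ 2 := by nlinarith
      nlinarith [mul_nonneg this (sub_nonneg.2 h₂)]
  · rw [profile_of_abs_le h.le (by linarith) hx, profile_of_abs_le h.le (by linarith) (by linarith)]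
    nlinarith [mul_nonneg (sub_nonneg.2 h₁) (sq_nonneg (w - ζ))]

lemma profile_strictAnti (h : ζ < u) (hζ : 0 ≤ ζ) (h₀ : -u < x) (h₁ : x < y) (hx : x < u) :
    profile u ζ y < profile u ζ x := by
  rcases le_total u y with hy | hy
  · rw [profile_of_le h.le hζ hy]
    rcases le_total ζ x with hx' | hx'
    · rw [profile_of_mem_Icc hx' hx.le hζ]
      nlinarith
    rcases le_total (-ζ) x with hx'' | hx''
    · rw [profile_of_abs_le h.le hx'' hx']
      nlinarith
    · rw [profile_of_le_neg h.le hζ hx'']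
      nlinarith
  rcases le_total ζ x with hx' | hx'
  · rw [profile_of_mem_Icc hx' hx.le hζ, profile_of_mem_Icc (by linarith) hy hζ]
    nlinarith
  rcases le_total (-ζ) x with hx'' | hx''
  · rw [profile_of_abs_le h.le hx'' hx']
    rcases le_total ζ y with hy' | hy'
    · rw [profile_of_mem_Icc hy' hy hζ]
      nlinarith
    · rw [profile_of_abs_le h.le (by linarith) hy']
      nlinarith
  · rw [profile_of_le_neg h.le hζ hx'']
    rcases le_total ζ y with hy' | hy'
    · rw [profile_of_mem_Icc hy' hy hζ]
      nlinarith
    rcases le_total (-ζ) y with hy'' | hy''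
    · rw [profile_of_abs_le h.le hy'' hy']
      nlinarith
    · rw [profile_of_le_neg h.le hζ hy'']
      nlinarith

end profile

lemma fob_eq_sum_profile {α : Fin 6 → ℝ} {ζ : ℝ} (h : FundamentalDomain α ζ)
    (hA : α 0 + α 1 ≤ 1) (hB : 0 ≤ α 3 + α 4) (hC : α 5 + ζ ≤ 0) :
    fob α ζ = profile (-α 5) ζ (α 0) + profile (-α 5) ζ (α 1) + profile (-α 5) ζ (α 2)
      + profile (-α 5) ζ (α 3) + profile (-α 5) ζ (α 4) - 2 * (α 5 ^ 2 - ζ ^ 2)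
      - posSq (ζ - α 5 - 1) := by
  rw [fob_eq_sum_correction h]
  obtain ⟨h01, h12, h23, h34, h45, h50, hζ0, hζ1, hs⟩ := h
  unfold profile
  simp (disch := grind) only [correction_of_mem_unit (x := α 0 + α 1),
    correction_of_mem_unit (x := α 0 + α 2), correction_of_mem_unit (x := α 0 + α 3),
    correction_of_mem_unit (x := α 0 + α 4), correction_of_mem_unit (x := α 1 + α 2),
    correction_of_mem_unit (x := α 1 + α 3), correction_of_mem_unit (x := α 1 + α 4),
    correction_of_mem_unit (x := α 2 + α 3), correction_of_mem_unit (x := α 2 + α 4),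
    correction_of_mem_unit (x := α 3 + α 4)]
  rw [correction_of_le_one (x := α 5 - ζ) (by linarith)]
  simp (disch := grind) only [correction_of_abs_le_one]
  rw [posSq_of_nonneg (x := -(α 5 - ζ)) (by linarith),
    posSq_of_nonneg (x := -(α 5 + ζ)) (by linarith)]
  ring_nf

lemma profile_chord_le_max {u ζ x y : ℝ} (h : ζ < u) (hζ : 0 ≤ ζ) (h₀ : 0 ≤ y) (h₁ : y ≤ x) :
    profile u ζ x * (u - y) ≤ profile u ζ y * max (u - x) 0 := by
  rcases le_total x u with hx | hx
  · rw [max_eq_left (by linarith)]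
    exact profile_chord_le h hζ h₀ h₁ hx
  · rw [profile_of_le h.le hζ hx, max_eq_right (by linarith)]
    simp

lemma profile_pos {u ζ x : ℝ} (h : ζ < u) (hζ : 0 ≤ ζ) (h₀ : 0 ≤ x) (h₁ : x < u) :
    0 < profile u ζ x := by
  simpa [profile_of_le h.le hζ le_rfl] using profile_strictAnti h hζ (by linarith) h₁ h₁

section sum_profile

variable {a b c d e u ζ : ℝ}

lemma sum_profile_lt_of_le (hab : b ≤ a) (hbc : c ≤ b) (hde : e ≤ d) (hcu : u ≤ c)
    (hζ : 0 ≤ ζ) (hζu : ζ < u) (heu : -u < e) (hB : 0 < d + e) :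
    profile u ζ a + profile u ζ b + profile u ζ c + profile u ζ d + profile u ζ e
      < 2 * (u ^ 2 - ζ ^ 2) := by
  rw [profile_of_le hζu.le hζ (x := a) (by linarith), profile_of_le hζu.le hζ (x := b)
    (by linarith), profile_of_le hζu.le hζ hcu]
  rcases le_or_gt u e with he | he
  · rw [profile_of_le hζu.le hζ (x := d) (by linarith), profile_of_le hζu.le hζ he]
    nlinarith
  · have h₁ := profile_strictAnti hζu hζ (x := -e) (y := d) (by linarith) (by linarith)
      (by linarith)
    have h₂ := profile_add_profile_neg hζu.le hζ heu.le he.le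
    linarith

lemma sum_profile_lt_of_chord (hab : b ≤ a) (hbc : c ≤ b) (hcd : d ≤ c) (hde : e ≤ d)
    (hcu : c < u) (hau : u ≤ a ∨ u ≤ 1 / 2) (hau' : a ≤ 1 - u)
    (hζ : 0 ≤ ζ) (hζu : ζ < u) (heu : -u < e) (hB : 0 < d + e) (hA : a + b ≤ 1)
    (hs : a + b + c + d + e = 1 + u) :
    profile u ζ a + profile u ζ b + profile u ζ c + profile u ζ d + profile u ζ e
      < 2 * (u ^ 2 - ζ ^ 2) := by
  rcases le_or_gt 0 e with he | he
  · have ha := profile_chord_le_max hζu hζ le_rfl (x := a) (by linarith)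
    have hb := profile_chord_le_max hζu hζ le_rfl (x := b) (by linarith)
    have hc := profile_chord_lt hζu hζ le_rfl (x := c) (by linarith) hcu
    have hd := profile_chord_le hζu hζ le_rfl (x := d) (by linarith) (by linarith)
    have he := profile_chord_le hζu hζ le_rfl (x := e) (by linarith) (by linarith)
    have h0 : profile u ζ 0 = u ^ 2 - ζ ^ 2 := by
      rw [profile_of_abs_le hζu.le (by linarith) hζ]
      ring
    have hm : max (u - a) 0 + max (u - b) 0 + (u - c) + (u - d) + (u - e) ≤ 2 * (u - 0) := by
      rcases le_total u a with h | h <;> rcases le_total u b with h' | h' <;>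
        simp only [max_eq_right, max_eq_left, sub_nonneg, sub_nonpos, h, h'] <;>
        rcases hau with hau | hau <;> linarith
    have := mul_le_mul_of_nonneg_left hm (profile_pos hζu hζ le_rfl (by linarith)).le
    refine lt_of_mul_lt_mul_right (a := u - 0) ?_ (by linarith)
    rw [← h0]
    linarith
  · have ha := profile_chord_le_max hζu hζ (y := -e) (by linarith) (x := a) (by linarith)
    have hb := profile_chord_le_max hζu hζ (y := -e) (by linarith) (x := b) (by linarith)
    have hc := profile_chord_lt hζu hζ (y := -e) (by linarith) (x := c) (by linarith) hcu
    have hd := profile_chord_le hζu hζ (y := -e) (by linarith) (x := d) (by linarith)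
      (by linarith)
    have h0 := profile_add_profile_neg hζu.le hζ heu.le (by linarith)
    have hm : max (u - a) 0 + max (u - b) 0 + (u - c) + (u - d) ≤ u - -e := by
      rcases le_total u a with h | h <;> rcases le_total u b with h' | h' <;>
        simp only [max_eq_right, max_eq_left, sub_nonneg, sub_nonpos, h, h'] <;>
        rcases hau with hau | hau <;> linarith
    have := mul_le_mul_of_nonneg_left hm
      (profile_pos hζu hζ (x := -e) (by linarith) (by linarith)).le
    have : profile u ζ a + profile u ζ b + profile u ζ c + profile u ζ d < profile u ζ (-e) := by
      refine lt_of_mul_lt_mul_right (a := u - -e) ?_ (by linarith)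
      linarith
    linarith

lemma sum_profile_lt_of_half_lt (hab : b ≤ a) (hbc : c ≤ b) (hcd : d ≤ c) (hde : e ≤ d)
    (hu : 1 / 2 < u) (hau : a ≤ 1 - u) (hζ : 0 ≤ ζ) (hζu : ζ ≤ 1 - u) (hB : 0 < d + e)
    (hs : a + b + c + d + e = 1 + u) :
    profile u ζ a + profile u ζ b + profile u ζ c + profile u ζ d + profile u ζ e
      < 2 * (u ^ 2 - ζ ^ 2) := by
  have hζu' : ζ < u := by linarith
  have hw : profile u ζ (1 - u) = (2 * u - 1) ^ 2 := by
    rw [profile_of_mem_Icc hζu (by linarith) hζ]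
    ring
  rcases le_or_gt 0 e with he | he
  · have key : ∀ x, e ≤ x → x ≤ a → _ := fun x hx hx' => profile_chord_le_of_zeta_le hζu' hζ
      le_rfl (x := x) (w := 1 - u) (by linarith) (by linarith) hζu (by linarith)
    have ha := key a (by linarith) (by linarith)
    have hb := key b (by linarith) (by linarith)
    have hc := key c (by linarith) (by linarith)
    have hd := key d (by linarith) (by linarith)
    have he := key e (by linarith) (by linarith)
    have h0 : profile u ζ 0 = u ^ 2 - ζ ^ 2 := by
      rw [profile_of_abs_le hζu'.le (by linarith) hζ]
      ring
    rw [hw] at ha hb hc hd he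
    refine lt_of_mul_lt_mul_right (a := 1 - u) ?_ (by linarith)
    have h1 : (1 + u) * (2 * u - 1) < 2 * (u ^ 2 - ζ ^ 2) := by nlinarith
    rw [← h0] at h1 ⊢
    have h2 := mul_lt_mul_of_pos_right h1 (show 0 < 2 * u - 1 by linarith)
    have h3 : a = 1 + u - b - c - d - e := by linarith
    rw [h3] at ha ⊢
    linarith
  · have key : ∀ x, d ≤ x → x ≤ a → _ := fun x hx hx' => profile_chord_le_of_zeta_le hζu' hζ
      (y := -e) (by linarith) (x := x) (w := 1 - u) (by linarith) (by linarith) hζu (by linarith)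
    have ha := key a (by linarith) (by linarith)
    have hb := key b (by linarith) (by linarith)
    have hc := key c (by linarith) (by linarith)
    have hd := key d (by linarith) (by linarith)
    have h0 := profile_add_profile_neg hζu'.le hζ (x := e) (by linarith) (by linarith)
    have he' : -e < 1 - u := by linarith
    rw [hw] at ha hb hc hd
    have h1 : (2 * u - 1) * (1 + u + 3 * e) < 2 * profile u ζ (-e) := by
      rcases le_total ζ (-e) with h | h
      · rw [profile_of_mem_Icc h (by linarith) hζ]
        nlinarith [mul_pos (show 0 < 2 * u - 1 by linarith) (sub_pos.2 he')]
      · rw [profile_of_abs_le hζu'.le (by linarith) h]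
        nlinarith [mul_pos (show 0 < 2 * u - 1 by linarith) (sub_pos.2 he')]
    have h2 := mul_lt_mul_of_pos_right h1 (show 0 < 2 * u - 1 by linarith)
    have : profile u ζ a + profile u ζ b + profile u ζ c + profile u ζ d < profile u ζ (-e) := by
      refine lt_of_mul_lt_mul_right (a := 1 - u - -e) ?_ (by linarith)
      have h3 : a = 1 + u - b - c - d - e := by linarith
      rw [h3] at ha ⊢
      linarith
    linarith

lemma sum_profile_eq_of_lt_zeta (hab : b ≤ a) (hbc : c ≤ b) (hcd : d ≤ c) (hde : e ≤ d)
    (hau : a ≤ 1 - u) (hζu : 1 - u ≤ ζ) (hζ : ζ ≤ 1 / 2) (hs : a + b + c + d + e = 1 + u) :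
    profile u ζ a + profile u ζ b + profile u ζ c + profile u ζ d + profile u ζ e
      - 2 * (u ^ 2 - ζ ^ 2) - posSq (ζ + u - 1) = -(1 - 2 * ζ) ^ 2 := by
  have key : ∀ x, e ≤ x → x ≤ a → profile u ζ x = u ^ 2 - ζ ^ 2 - 2 * (u - ζ) * x :=
    fun x hx hx' => profile_of_abs_le (by linarith) (by linarith) (by linarith)
  rw [key a (by linarith) (by linarith), key b (by linarith) (by linarith),
    key c (by linarith) (by linarith), key d (by linarith) (by linarith),
    key e (by linarith) (by linarith), posSq_of_nonneg (by linarith)]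
  have h3 : a = 1 + u - b - c - d - e := by linarith
  rw [h3]
  ring

end sum_profile

lemma classified_of_add_zeta_nonpos {α : Fin 6 → ℝ} {ζ : ℝ} (h : FundamentalDomain α ζ)
    (hA : α 0 + α 1 ≤ 1) (hB : 0 ≤ α 3 + α 4) (hC : α 5 + ζ ≤ 0) : Classified α ζ := by
  rw [Classified, fob_eq_sum_profile h hA hB hC]
  obtain ⟨h01, h12, h23, h34, h45, h50, hζ0, hζ1, hs⟩ := h
  obtain ⟨u, hu⟩ : ∃ u, u = -α 5 := ⟨_, rfl⟩
  have hu' : α 5 = -u := by linarith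
  rw [← hu, hu', neg_sq, sub_neg_eq_add]
  rcases hC.eq_or_lt with hC | hC
  · refine iff_of_true ?_ (Or.inl ⟨by linarith, hA, hB⟩)
    obtain rfl : u = ζ := by linarith
    have key : ∀ x, -u ≤ x → profile u u x = 0 := fun x hx => by
      rw [profile, posSq_of_nonpos (x := -u - x) (by linarith)]
      ring
    rw [key _ (by linarith), key _ (by linarith), key _ (by linarith), key _ (by linarith),
      key _ (by linarith), posSq_of_nonpos (by linarith)]
    ring
  have hζu : ζ < u := by linarith
  rcases h45.eq_or_lt with h45 | h45
  · refine iff_of_true ?_ (by iterate 13 right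
                              exact ⟨h45.symm, hB, hC.le⟩)
    have key : ∀ x, u ≤ x → profile u ζ x = 0 := fun x hx => profile_of_le hζu.le hζ0 hx
    have h0 := profile_add_profile_neg hζu.le hζ0 (x := u) (by linarith) le_rfl
    rw [key _ le_rfl] at h0
    rw [← h45, hu', key _ (by linarith), key _ (by linarith), key _ (by linarith),
      key _ (by linarith), posSq_of_nonpos (by linarith)]
    linarith
  rcases hB.eq_or_lt with hB | hB
  · refine iff_of_true ?_ (Or.inr <| Or.inr <| Or.inl ⟨hB.symm, by linarith, hC.le⟩)
    have key : ∀ x, u ≤ x → profile u ζ x = 0 := fun x hx => profile_of_le hζu.le hζ0 hx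
    have h0 := profile_add_profile_neg hζu.le hζ0 (x := α 3) (by linarith) (by linarith)
    rw [show α 4 = -α 3 by linarith, key _ (by linarith), key _ (by linarith),
      key _ (by linarith), posSq_of_nonpos (by linarith)]
    linarith
  rcases hζ1.eq_or_lt with hζ | hζ
  · refine iff_of_true ?_ (by iterate 10 right
                              exact Or.inl ⟨hζ, by linarith⟩)
    rw [sum_profile_eq_of_lt_zeta h01 h12 h23 h34 (by linarith) (by linarith) hζ1 (by linarith),
      hζ]
    norm_num
  refine iff_of_false (ne_of_lt ?_) ?_
  · have hp := posSq_nonneg (ζ + u - 1)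
    rcases le_or_gt u (α 2) with h2 | h2
    · linarith [sum_profile_lt_of_le h01 h12 h34 h2 hζ0 hζu (by linarith) hB]
    by_cases h0 : u ≤ α 0 ∨ u ≤ 1 / 2
    · linarith [sum_profile_lt_of_chord h01 h12 h23 h34 h2 h0 (by linarith) hζ0 hζu
        (by linarith) hB hA (by linarith)]
    push Not at h0
    rcases le_total ζ (1 - u) with h1 | h1
    · linarith [sum_profile_lt_of_half_lt h01 h12 h23 h34 h0.2 (by linarith) hζ0 h1 hB
        (by linarith)]
    · rw [sum_profile_eq_of_lt_zeta h01 h12 h23 h34 (by linarith) h1 hζ1 (by linarith)]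
      nlinarith
  · rintro (h | h | h | h | h | h | h | h | h | h | h | h | h | h) <;> linarith

lemma classified_of_nonneg {α : Fin 6 → ℝ} {ζ : ℝ} (h : FundamentalDomain α ζ)
    (hA : α 0 + α 1 ≤ 1) (hB : 0 ≤ α 3 + α 4) : Classified α ζ := by
  rcases le_total (α 5 + ζ) 0 with hC | hC
  · exact classified_of_add_zeta_nonpos h hA hB hC
  · refine .of_reflect h (classified_of_add_zeta_nonpos h.reflect ?_ ?_ ?_) <;>
      simp only [reflect, Matrix.cons_val] <;> linarith

lemma classified_of_nonpos {α : Fin 6 → ℝ} {ζ : ℝ} (h : FundamentalDomain α ζ)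
    (hA : α 0 + α 1 ≤ 1) (hB : α 3 + α 4 ≤ 0) : Classified α ζ := by
  rcases le_total (α 5 + ζ) 0 with hC | hC
  · exact classified_of_zeta_le h hA hB hC
  rcases le_total ζ (α 2) with hD | hD
  · exact classified_of_zeta_between h hA hB hC hD
  · refine .of_halfShift h (classified_of_zeta_le h.halfShift ?_ ?_ ?_) <;>
      simp only [halfShift, Matrix.cons_val] <;> linarith

lemma FundamentalDomain.classified {α : Fin 6 → ℝ} {ζ : ℝ} (h : FundamentalDomain α ζ) :
    Classified α ζ := by
  rcases le_total (α 0 + α 1) 1 with hA | hA <;> rcases le_total (α 3 + α 4) 0 with hB | hB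
  · exact classified_of_nonpos h hA hB
  · exact classified_of_nonneg h hA hB
  · refine .of_halfShift h (classified_of_nonneg h.halfShift ?_ ?_) <;>
      simp only [_root_.halfShift, Matrix.cons_val] <;> linarith
  · refine .of_reflect h (classified_of_nonpos h.reflect ?_ ?_) <;>
      simp only [_root_.reflect, Matrix.cons_val] <;> linarith

/-- Complete description of the zero set of `fob` on the fundamental domain of
the translation-and-permutation action: fourteen polytopal pieces. -/
theorem fob_zero_set_classification
    (α : Fin 6 → ℝ) (ζ : ℝ)
    (h01 : α 1 ≤ α 0) (h12 : α 2 ≤ α 1) (h23 : α 3 ≤ α 2)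
    (h34 : α 4 ≤ α 3) (h45 : α 5 ≤ α 4) (h50 : α 0 - 1 ≤ α 5)
    (hζ0 : 0 ≤ ζ) (hζ1 : ζ ≤ 1 / 2)
    (hsum : ∑ r, α r = 1) :
    fob α ζ = 0 ↔
      (ζ = -α 5 ∧ α 0 + α 1 ≤ 1 ∧ 0 ≤ α 3 + α 4) ∨
      (ζ = α 2 ∧ 1 ≤ α 0 + α 1 ∧ α 3 + α 4 ≤ 0) ∨
      (α 3 + α 4 = 0 ∧ ζ ≤ α 2 ∧ α 5 + ζ ≤ 0) ∨
      (α 0 + α 1 = 1 ∧ α 2 ≤ ζ ∧ 0 ≤ α 5 + ζ) ∨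
      (ζ = 0 ∧ 0 ≤ α 5) ∨
      (α 2 = α 3 ∧ ζ ≤ α 2 ∧ α 3 + α 4 ≤ 0) ∨
      (α 0 = α 5 + 1 ∧ -α 5 ≤ ζ ∧ α 0 + α 1 ≤ 1) ∨
      (ζ = 1 / 2 ∧ 1 / 2 ≤ α 2) ∨
      (ζ = -(α 3 + α 4 + α 5) ∧ α 3 + α 4 ≤ 0 ∧ α 0 + α 1 ≤ 1) ∨
      (ζ = 0 ∧ α 2 ≤ 0) ∨
      (ζ = 1 / 2 ∧ α 5 ≤ -(1 / 2)) ∨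
      (ζ = α 2 + α 3 + α 4 ∧ 1 ≤ α 0 + α 1 ∧ 0 ≤ α 3 + α 4) ∨
      (α 1 = α 2 ∧ α 2 ≤ ζ ∧ 1 ≤ α 0 + α 1) ∨
      (α 4 = α 5 ∧ 0 ≤ α 3 + α 4 ∧ α 5 + ζ ≤ 0) :=
  FundamentalDomain.classified ⟨h01, h12, h23, h34, h45, h50, hζ0, hζ1,
    by rwa [Fin.sum_univ_six] at hsum⟩
end

section
/- Let e₁, …, e₆ be the standard basis of ℝ⁶ and let ρ' := (1/2, 1/2, 1/2, 1/2, 1/2, 1/2) ∈ ℝ⁶. Fix β ∈ ℝ⁶ and a ∈ {1, …, 6}, and let P be the convex hull (in ℝ⁶) of the ten points { β + e_r : r ≠ a } ∪ { β + ρ' − e_a − e_r : r ≠ a }. Then P equals the set of all α ∈ ℝ⁶ satisfying: Σ_{r=1}^{6} (α_r − β_r) = 1; −1/2 ≤ α_a − β_a ≤ 0; for every r ≠ a, α_a − β_a ≤ α_r − β_r ≤ 1 + α_a − β_a; and for all r < s with r, s ≠ a, 0 ≤ (α_r − β_r) + (α_s − β_s) ≤ 1. (This is the description of the cross polytope P_{II,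 β, a} by its bounding inequalities.) -/
/-- The `r`-th standard basis vector of `ℝ⁶`. -/
noncomputable def stdE (r : Fin 6) : Fin 6 → ℝ := Pi.single r 1

/-- The half vector `ρ' = (1/2, …, 1/2) ∈ ℝ⁶`. -/
noncomputable def rhoHalf : Fin 6 → ℝ := fun _ => 1 / 2

lemma sum_abs_le_one_of_pair_bounds (u : Fin 5 → ℝ) (t : ℝ) (hu : ∑ i, u i = 1 - 4 * t)
    (h0 : 0 ≤ t) (h1 : t ≤ 1 / 2)
    (hs : ∀ i, -(2 * t) ≤ u i ∧ u i ≤ 1 - 2 * t)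
    (hp : ∀ i j, i < j → -(2 * t) ≤ u i + u j ∧ u i + u j ≤ 1 - 2 * t) :
    ∑ i, |u i| ≤ 1 := by
  simp only [Fin.sum_univ_five] at *
  have s0 := hs 0
  have s1 := hs 1
  have s2 := hs 2
  have s3 := hs 3
  have s4 := hs 4
  have p01 := hp 0 1 (by decide)
  have p02 := hp 0 2 (by decide)
  have p03 := hp 0 3 (by decide)
  have p04 := hp 0 4 (by decide)
  have p12 := hp 1 2 (by decide)
  have p13 := hp 1 3 (by decide)
  have p14 := hp 1 4 (by decide)
  have p23 := hp 2 3 (by decide)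
  have p24 := hp 2 4 (by decide)
  have p34 := hp 3 4 (by decide)
  clear hs hp
  rcases abs_choice (u 0) with e0 | e0 <;> rcases abs_choice (u 1) with e1 | e1 <;>
  rcases abs_choice (u 2) with e2 | e2 <;> rcases abs_choice (u 3) with e3 | e3 <;>
  rcases abs_choice (u 4) with e4 | e4 <;> rw [e0, e1, e2, e3, e4] <;>
  clear e0 e1 e2 e3 e4 <;> linarith

lemma convex_crossPolytope_inequalities (β : Fin 6 → ℝ) (a : Fin 6) :
    Convex ℝ {α : Fin 6 → ℝ |
          (∑ r : Fin 6, (α r - β r)) = 1 ∧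
          -(1 / 2) ≤ α a - β a ∧ α a - β a ≤ 0 ∧
          (∀ r : Fin 6, r ≠ a →
            α a - β a ≤ α r - β r ∧ α r - β r ≤ 1 + (α a - β a)) ∧
          (∀ r s : Fin 6, r < s → r ≠ a → s ≠ a →
            0 ≤ (α r - β r) + (α s - β s) ∧ (α r - β r) + (α s - β s) ≤ 1)} := by
  rintro x ⟨x1, x2, x3, x4, x5⟩ y ⟨y1, y2, y3, y4, y5⟩ p q hp hq hpq
  have key : ∀ r, (p • x + q • y) r - β r = p * (x r - β r) + q * (y r - β r) := by
    intro r
    simp only [Pi.add_apply, Pi.smul_apply, smul_eq_mul]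
    linear_combination β r * hpq
  simp only [Set.mem_ofPred_eq, key]
  refine ⟨?_, by nlinarith, by nlinarith, fun r hr => ?_, fun r s hrs hr hs => ?_⟩
  · rw [Finset.sum_add_distrib, ← Finset.mul_sum, ← Finset.mul_sum, x1, y1]
    linarith
  · obtain ⟨a1, a2⟩ := x4 r hr
    obtain ⟨b1, b2⟩ := y4 r hr
    constructor <;> nlinarith
  · obtain ⟨a1, a2⟩ := x5 r s hrs hr hs
    obtain ⟨b1, b2⟩ := y5 r s hrs hr hs
    constructor <;> nlinarith

/-- Description of the cross polytope `P_{II, β, a}` (the convex hull of the ten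
points `β + e_r` and `β + ρ' − e_a − e_r`, `r ≠ a`) by its bounding inequalities. -/
theorem crossPolytope_eq_inequalities (β : Fin 6 → ℝ) (a : Fin 6) :
    convexHull ℝ
        ({x | ∃ r : Fin 6, r ≠ a ∧ x = β + stdE r}
          ∪ {x | ∃ r : Fin 6, r ≠ a ∧ x = β + rhoHalf - stdE a - stdE r})
      = {α : Fin 6 → ℝ |
          (∑ r : Fin 6, (α r - β r)) = 1 ∧
          -(1 / 2) ≤ α a - β a ∧ α a - β a ≤ 0 ∧
          (∀ r : Fin 6, r ≠ a →
            α a - β a ≤ α r - β r ∧ α r - β r ≤ 1 + (α a - β a)) ∧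
          (∀ r s : Fin 6, r < s → r ≠ a → s ≠ a →
            0 ≤ (α r - β r) + (α s - β s) ∧ (α r - β r) + (α s - β s) ≤ 1)} := by
  apply Set.Subset.antisymm
  · refine convexHull_min ?_ (convex_crossPolytope_inequalities β a)
    rintro x (⟨r, hr, rfl⟩ | ⟨r, hr, rfl⟩)
    · simp only [Set.mem_ofPred_eq, Pi.add_apply, stdE, Pi.single_apply, add_sub_cancel_left]
      refine ⟨by simp, ?_, ?_, fun k hk => ?_, fun k l hkl hk hl => ?_⟩
      · simp [hr.symm]
      · simp [hr.symm]
      · rw [if_neg hr.symm]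
        split_ifs <;> norm_num
      · have : ¬ (k = r ∧ l = r) := fun h => hkl.ne (h.1.trans h.2.symm)
        split_ifs <;> first | (exfalso; tauto) | norm_num
    · have key : ∀ k, (β + rhoHalf - stdE a - stdE r) k - β k =
          1 / 2 - (if k = a then 1 else 0) - (if k = r then 1 else 0) := by
        intro k
        simp only [Pi.add_apply, Pi.sub_apply, stdE, rhoHalf, Pi.single_apply]
        ring
      simp only [Set.mem_ofPred_eq, key]
      refine ⟨?_, ?_, ?_, fun k hk => ?_, fun k l hkl hk hl => ?_⟩
      · simp [Finset.sum_sub_distrib]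
        norm_num
      · simp [hr.symm]; norm_num
      · simp [hr.symm]; norm_num
      · simp only [if_neg hr.symm, if_neg hk, if_true]
        split_ifs <;> norm_num
      · have : ¬ (k = r ∧ l = r) := fun h => hkl.ne (h.1.trans h.2.symm)
        simp only [if_neg hl, if_neg hk]
        split_ifs <;> first | (exfalso; tauto) | norm_num
  · rintro x ⟨x1, x2, x3, x4, x5⟩
    obtain ⟨u, hu⟩ : ∃ u : Fin 5 → ℝ, ∀ i, u i =
        (x (a.succAbove i) - β (a.succAbove i)) + (x a - β a) := ⟨_, fun _ => rfl⟩
    have hU : ∑ i, u i = 1 - 4 * -(x a - β a) := by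
      rw [Fin.sum_univ_succAbove _ a] at x1
      simp only [hu, Finset.sum_add_distrib, Finset.sum_const, Finset.card_univ,
        Fintype.card_fin, nsmul_eq_mul]
      push_cast
      linarith
    have hS : ∑ i, |u i| ≤ 1 := by
      refine sum_abs_le_one_of_pair_bounds u _ hU (by linarith) (by linarith)
        (fun i => ?_) (fun i j hij => ?_)
      · have := x4 _ (Fin.succAbove_ne a i)
        rw [hu]
        constructor <;> linarith
      · have := x5 _ _ (Fin.strictMono_succAbove a hij) (Fin.succAbove_ne a i)
          (Fin.succAbove_ne a j)
        rw [hu, hu]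
        constructor <;> linarith
    obtain ⟨d, hd⟩ : ∃ d : ℝ, d = (1 - ∑ i, |u i|) / 10 := ⟨_, rfl⟩
    have hd0 : 0 ≤ d := by rw [hd]; linarith
    have hmem := (convex_convexHull ℝ
        ({x | ∃ r : Fin 6, r ≠ a ∧ x = β + stdE r}
          ∪ {x | ∃ r : Fin 6, r ≠ a ∧ x = β + rhoHalf - stdE a - stdE r})).sum_mem
      (t := (Finset.univ : Finset (Fin 5 ⊕ Fin 5)))
      (w := Sum.elim (fun i => (|u i| + u i) / 2 + d) (fun i => (|u i| - u i) / 2 + d))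
      (z := Sum.elim (fun i => β + stdE (a.succAbove i))
        (fun i => β + rhoHalf - stdE a - stdE (a.succAbove i)))
      (by
        rintro (i | i) -
        · have := neg_abs_le (u i)
          simp only [Sum.elim_inl]
          linarith
        · have := le_abs_self (u i)
          simp only [Sum.elim_inr]
          linarith)
      (by
        simp only [Fintype.sum_sum_type, Sum.elim_inl, Sum.elim_inr]
        simp only [Fin.sum_univ_five] at hd ⊢
        linarith)
      (by
        rintro (i | i) -
        · exact subset_convexHull ℝ _ (Or.inl ⟨_, Fin.succAbove_ne a i, rfl⟩)
        · exact subset_convexHull ℝ _ (Or.inr ⟨_, Fin.succAbove_ne a i, rfl⟩))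
    convert hmem using 1
    ext k
    simp only [Fintype.sum_sum_type, Sum.elim_inl, Sum.elim_inr, Pi.add_apply, Finset.sum_apply,
      Pi.smul_apply, Pi.sub_apply, smul_eq_mul, stdE, rhoHalf, Pi.single_apply]
    rcases Fin.eq_self_or_eq_succAbove a k with rfl | ⟨j, rfl⟩
    · simp only [(Fin.succAbove_ne k _).symm, if_true, if_false]
      simp only [Fin.sum_univ_five] at hd hU ⊢
      linear_combination (-10 * β k + 5 / 2) * hd - (1 / 4) * hU
    · have huj := hu j
      simp only [Fin.succAbove_ne, if_false, Fin.succAbove_right_inj]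
      generalize β (a.succAbove j) = b at *
      simp only [Fin.sum_univ_five] at hd hU ⊢
      fin_cases j <;> simp at huj ⊢ <;>
      linear_combination (-10 * b - 5 / 2) * hd + (1 / 4) * hU - huj
end

section
/- Let e₁, …, e₆ be the standard basis of ℝ⁶, ρ' := (1/2, …, 1/2) ∈ ℝ⁶, L := ℤ⁶ ∪ (ℤ⁶ + ρ'), and H := { α ∈ ℝ⁶ : α₁ + ⋯ + α₆ = 1 }. Consider the family F of polytopes in H consisting of: P_I(β) := conv{ β + e_r : 1 ≤ r ≤ 6 } for β ∈ L with Σβ_r = 0; P̂_I(γ) := conv{ γ − e_r : 1 ≤ r ≤ 6 } for γ ∈ L with Σγ_r = 2; P_III(β, {a,b,c}) := conv{ β + e_a, β + e_b, β + e_c, β + ρ' − e_d − e_e, β + ρ' − e_e − e_f, β + ρ' − e_f − e_d } for β ∈ ℤ⁶ with Σβ_r = 0 and each 3-element subset {a,b,c} ⊂ {1,…,6} with complement {d,e,f}; P̂_III(γ, {a,b,c}) := conv{ γ − e_a, γ − e_b, γ − e_c, γ − ρ' + e_d + e_e, γ − ρ' + e_e + e_f, γ − ρ' + e_f + e_d }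 for γ ∈ ℤ⁶ with Σγ_r = 2 and each 3-element subset {a,b,c}; and P_II(β, a) := conv( { β + e_r : r ≠ a } ∪ { β + ρ' − e_a − e_r : r ≠ a } ) for β ∈ L with Σβ_r = 0 and a ∈ {1,…,6}. Then: (i) the union of all polytopes in F equals H; and (ii) any two distinct polytopes in F have disjoint relative interiors (interiors taken within the affine hyperplane H). -/
/-- `v ∈ ℤ⁶`. -/
def isIntVec (v : Fin 6 → ℝ) : Prop := ∀ r, ∃ k : ℤ, v r = k

/-- `v ∈ L = ℤ⁶ ∪ (ℤ⁶ + ρ')`. -/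
def inLatticeL (v : Fin 6 → ℝ) : Prop := isIntVec v ∨ isIntVec (v - rhoHalf)

/-- The simplex `P_I(β) = conv{β + e_r}`. -/
noncomputable def polyPI (β : Fin 6 → ℝ) : Set (Fin 6 → ℝ) :=
  convexHull ℝ {x | ∃ r : Fin 6, x = β + stdE r}

/-- The simplex `P̂_I(γ) = conv{γ − e_r}`. -/
noncomputable def polyPIhat (γ : Fin 6 → ℝ) : Set (Fin 6 → ℝ) :=
  convexHull ℝ {x | ∃ r : Fin 6, x = γ - stdE r}

/-- The simplex `P_III(β, {a,b,c})`, with vertices `β + e_r` for `r ∈ {a,b,c}` and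
`β + ρ' − e_d − e_e` for each pair `{d,e}` in the complement `{d,e,f}`. -/
noncomputable def polyPIII (β : Fin 6 → ℝ) (abc : Finset (Fin 6)) : Set (Fin 6 → ℝ) :=
  convexHull ℝ
    ({x | ∃ r ∈ abc, x = β + stdE r}
      ∪ {x | ∃ f ∈ abcᶜ, x = β + rhoHalf - ∑ r ∈ abcᶜ \ {f}, stdE r})

/-- The simplex `P̂_III(γ, {a,b,c})`, with vertices `γ − e_r` for `r ∈ {a,b,c}` and
`γ − ρ' + e_d + e_e` for each pair `{d,e}` in the complement `{d,e,f}`. -/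
noncomputable def polyPIIIhat (γ : Fin 6 → ℝ) (abc : Finset (Fin 6)) : Set (Fin 6 → ℝ) :=
  convexHull ℝ
    ({x | ∃ r ∈ abc, x = γ - stdE r}
      ∪ {x | ∃ f ∈ abcᶜ, x = γ - rhoHalf + ∑ r ∈ abcᶜ \ {f}, stdE r})

/-- The cross polytope `P_II(β, a)` with vertices `β + e_r` and `β + ρ' − e_a − e_r`
for `r ≠ a`. -/
noncomputable def polyPII (β : Fin 6 → ℝ) (a : Fin 6) : Set (Fin 6 → ℝ) :=
  convexHull ℝ
    ({x | ∃ r : Fin 6, r ≠ a ∧ x = β + stdE r}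
      ∪ {x | ∃ r : Fin 6, r ≠ a ∧ x = β + rhoHalf - stdE a - stdE r})

/-- The family `F` of polytopes tiling the hyperplane `{α : Σ α_r = 1}`. -/
def tilingFamily : Set (Set (Fin 6 → ℝ)) :=
  {P | (∃ β : Fin 6 → ℝ, inLatticeL β ∧ (∑ r, β r) = 0 ∧ P = polyPI β)
     ∨ (∃ γ : Fin 6 → ℝ, inLatticeL γ ∧ (∑ r, γ r) = 2 ∧ P = polyPIhat γ)
     ∨ (∃ β : Fin 6 → ℝ, isIntVec β ∧ (∑ r, β r) = 0 ∧
          ∃ abc : Finset (Fin 6), abc.card = 3 ∧ P = polyPIII β abc)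
     ∨ (∃ γ : Fin 6 → ℝ, isIntVec γ ∧ (∑ r, γ r) = 2 ∧
          ∃ abc : Finset (Fin 6), abc.card = 3 ∧ P = polyPIIIhat γ abc)
     ∨ (∃ β : Fin 6 → ℝ, inLatticeL β ∧ (∑ r, β r) = 0 ∧
          ∃ a : Fin 6, P = polyPII β a)}

/-! ### Model cells -/

/-- The points of `L` on the hyperplane `Σ α_r = 1`, which are the vertices of the tiling. -/
def latticeOne : Set (Fin 6 → ℝ) := {v | inLatticeL v ∧ ∑ r, v r = 1}

/-- The vertices of `P_I(0)`. -/
def vertsI : Set (Fin 6 → ℝ) := {v | ∃ r : Fin 6, v = stdE r}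

/-- The vertices of `P_II(0, a)`. -/
def vertsII (a : Fin 6) : Set (Fin 6 → ℝ) :=
  {v | ∃ r : Fin 6, r ≠ a ∧ v = stdE r} ∪ {v | ∃ r : Fin 6, r ≠ a ∧ v = rhoHalf - stdE a - stdE r}

/-- The vertices of `P_III(0, A)`. -/
def vertsIII (A : Finset (Fin 6)) : Set (Fin 6 → ℝ) :=
  {v | ∃ r ∈ A, v = stdE r} ∪ {v | ∃ f ∈ Aᶜ, v = rhoHalf - ∑ r ∈ Aᶜ \ {f}, stdE r}

section Translates

open Pointwise

theorem polyPI_eq (β : Fin 6 → ℝ) :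
    polyPI β = convexHull ℝ ((fun v => β + v) '' vertsI) := by
  unfold polyPI vertsI
  congr 1
  ext x
  constructor
  · rintro ⟨r, rfl⟩
    exact ⟨_, ⟨r, rfl⟩, rfl⟩
  · rintro ⟨_, ⟨r, rfl⟩, rfl⟩
    exact ⟨r, rfl⟩

theorem polyPIhat_eq (γ : Fin 6 → ℝ) :
    polyPIhat γ = convexHull ℝ ((fun v => γ - v) '' vertsI) := by
  unfold polyPIhat vertsI
  congr 1
  ext x
  constructor
  · rintro ⟨r, rfl⟩
    exact ⟨_, ⟨r, rfl⟩, rfl⟩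
  · rintro ⟨_, ⟨r, rfl⟩, rfl⟩
    exact ⟨r, rfl⟩

theorem polyPII_eq (β : Fin 6 → ℝ) (a : Fin 6) :
    polyPII β a = convexHull ℝ ((fun v => β + v) '' vertsII a) := by
  unfold polyPII vertsII
  congr 1
  ext x
  constructor
  · rintro (⟨r, hr, rfl⟩ | ⟨r, hr, rfl⟩)
    · exact ⟨_, .inl ⟨r, hr, rfl⟩, rfl⟩
    · exact ⟨_, .inr ⟨r, hr, rfl⟩, by dsimp only; abel⟩
  · rintro ⟨_, ⟨r, hr, rfl⟩ | ⟨r, hr, rfl⟩, rfl⟩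
    · exact .inl ⟨r, hr, rfl⟩
    · exact .inr ⟨r, hr, by dsimp only; abel⟩

theorem polyPIII_eq (β : Fin 6 → ℝ) (A : Finset (Fin 6)) :
    polyPIII β A = convexHull ℝ ((fun v => β + v) '' vertsIII A) := by
  unfold polyPIII vertsIII
  congr 1
  ext x
  constructor
  · rintro (⟨r, hr, rfl⟩ | ⟨r, hr, rfl⟩)
    · exact ⟨_, .inl ⟨r, hr, rfl⟩, rfl⟩
    · exact ⟨_, .inr ⟨r, hr, rfl⟩, by dsimp only; abel⟩
  · rintro ⟨_, ⟨r, hr, rfl⟩ | ⟨r, hr, rfl⟩, rfl⟩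
    · exact .inl ⟨r, hr, rfl⟩
    · exact .inr ⟨r, hr, by dsimp only; abel⟩

theorem polyPIIIhat_eq (γ : Fin 6 → ℝ) (A : Finset (Fin 6)) :
    polyPIIIhat γ A = convexHull ℝ ((fun v => γ - v) '' vertsIII A) := by
  unfold polyPIIIhat vertsIII
  congr 1
  ext x
  constructor
  · rintro (⟨r, hr, rfl⟩ | ⟨r, hr, rfl⟩)
    · exact ⟨_, .inl ⟨r, hr, rfl⟩, rfl⟩
    · exact ⟨_, .inr ⟨r, hr, rfl⟩, by dsimp only; abel⟩
  · rintro ⟨_, ⟨r, hr, rfl⟩ | ⟨r, hr, rfl⟩, rfl⟩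
    · exact .inl ⟨r, hr, rfl⟩
    · exact .inr ⟨r, hr, by dsimp only; abel⟩

theorem mem_convexHull_image_add {S : Set (Fin 6 → ℝ)} {β x : Fin 6 → ℝ}
    (h : x - β ∈ convexHull ℝ S) : x ∈ convexHull ℝ ((fun v => β + v) '' S) := by
  have : (fun v => β + v) '' S = β +ᵥ S := rfl
  rw [this, convexHull_vadd, Set.mem_vadd_set]
  exact ⟨x - β, h, by simp⟩

theorem mem_convexHull_image_sub {S : Set (Fin 6 → ℝ)} {γ x : Fin 6 → ℝ}
    (h : γ - x ∈ convexHull ℝ S) : x ∈ convexHull ℝ ((fun v => γ - v) '' S) := by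
  have : (fun v => γ - v) '' S = γ +ᵥ -S := by
    ext y
    simp only [Set.mem_image, Set.mem_vadd_set, Set.mem_neg, vadd_eq_add]
    constructor
    · rintro ⟨v, hv, rfl⟩
      exact ⟨-v, by simpa using hv, by abel⟩
    · rintro ⟨v, hv, rfl⟩
      exact ⟨-v, hv, by abel⟩
  rw [this, convexHull_vadd, convexHull_neg, Set.mem_vadd_set]
  exact ⟨x - γ, by simpa using h, by simp⟩

end Translates

/-! ### Empty spheres -/

/-- `S` is the set of all lattice points on a sphere with no lattice point in its interior;
the sphere is the zero set of `v ⬝ v + c ⬝ v + d`. -/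
def IsDelaunay (S : Set (Fin 6 → ℝ)) : Prop :=
  S ⊆ latticeOne ∧ ∃ (c : Fin 6 → ℝ) (d : ℝ), ∀ v ∈ latticeOne,
    0 ≤ v ⬝ᵥ v + c ⬝ᵥ v + d ∧ (v ⬝ᵥ v + c ⬝ᵥ v + d = 0 ↔ v ∈ S)

theorem convexHull_subset_halfSpace {S : Set (Fin 6 → ℝ)} {c : Fin 6 → ℝ} {d : ℝ}
    (h : ∀ v ∈ S, 0 ≤ c ⬝ᵥ v + d) {x : Fin 6 → ℝ} (hx : x ∈ convexHull ℝ S) :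
    0 ≤ c ⬝ᵥ x + d := by
  refine convexHull_min (t := {x | 0 ≤ c ⬝ᵥ x + d}) h ?_ hx
  intro u hu v hv s t hs ht hst
  simp only [Set.mem_ofPred_eq, dotProduct_add, dotProduct_smul, smul_eq_mul] at *
  obtain rfl : t = 1 - s := by linarith
  nlinarith [mul_nonneg hs hu, mul_nonneg ht hv]

theorem exists_add_smul_sub_mem_of_mem_intrinsicInterior {S : Set (Fin 6 → ℝ)} {x s : Fin 6 → ℝ}
    (hx : x ∈ intrinsicInterior ℝ S) (hs : s ∈ S) :
    ∃ ε : ℝ, 0 < ε ∧ x + ε • (x - s) ∈ S := by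
  obtain ⟨y, hy, rfl⟩ := mem_intrinsicInterior.1 hx
  have : Nonempty (affineSpan ℝ S) := ⟨y⟩
  set s' : affineSpan ℝ S := ⟨s, subset_affineSpan ℝ S hs⟩
  have hcont : Continuous fun ε : ℝ => (AffineMap.lineMap y s' (-ε) : affineSpan ℝ S) := by
    refine continuous_induced_rng.2 ?_
    have : (Subtype.val ∘ fun ε : ℝ => (AffineMap.lineMap y s' (-ε) : affineSpan ℝ S)) =
        fun ε : ℝ => AffineMap.lineMap (y : Fin 6 → ℝ) s (-ε) := by
      ext1 ε
      exact (affineSpan ℝ S).subtype.apply_lineMap y s' (-ε)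
    rw [this]
    simp only [AffineMap.lineMap_apply]
    fun_prop
  have hev : ∀ᶠ ε : ℝ in nhdsWithin 0 (Set.Ioi 0),
      (AffineMap.lineMap y s' (-ε) : affineSpan ℝ S) ∈
        interior ((↑) ⁻¹' S : Set (affineSpan ℝ S)) := by
    refine (hcont.tendsto 0).eventually_mem ?_ |>.filter_mono nhdsWithin_le_nhds
    simpa using isOpen_interior.mem_nhds hy
  obtain ⟨ε, hε, hpos⟩ := (hev.and self_mem_nhdsWithin).exists
  refine ⟨ε, hpos, ?_⟩
  have h1 : (AffineMap.lineMap y s' (-ε) : affineSpan ℝ S) ∈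
      ((↑) ⁻¹' S : Set (affineSpan ℝ S)) := interior_subset hε
  have h2 : ((AffineMap.lineMap y s' (-ε) : affineSpan ℝ S) : Fin 6 → ℝ) =
      AffineMap.lineMap (y : Fin 6 → ℝ) s (-ε) :=
    (affineSpan ℝ S).subtype.apply_lineMap y s' (-ε)
  rw [Set.mem_preimage, h2, AffineMap.lineMap_apply] at h1
  convert h1 using 1
  simp only [vsub_eq_sub, vadd_eq_add]
  module

theorem IsDelaunay.subset_of_mem_interiors {S T : Set (Fin 6 → ℝ)} (hS : IsDelaunay S)
    (hT : IsDelaunay T) {x : Fin 6 → ℝ} (hxS : x ∈ intrinsicInterior ℝ (convexHull ℝ S))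
    (hxT : x ∈ convexHull ℝ T) : S ⊆ T := by
  obtain ⟨hSL, c, d, hc⟩ := hS
  obtain ⟨hTL, c', d', hc'⟩ := hT
  have hD : ∀ v ∈ S, 0 ≤ (c' - c) ⬝ᵥ v + (d' - d) := fun v hv => by
    have h1 := (hc v (hSL hv)).2.2 hv
    have h2 := (hc' v (hSL hv)).1
    rw [sub_dotProduct]
    linarith
  have hD' : ∀ v ∈ T, 0 ≤ (c - c') ⬝ᵥ v + (d - d') := fun v hv => by
    have h1 := (hc' v (hTL hv)).2.2 hv
    have h2 := (hc v (hTL hv)).1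
    rw [sub_dotProduct]
    linarith
  intro s hs
  obtain ⟨ε, hε, hy⟩ :=
    exists_add_smul_sub_mem_of_mem_intrinsicInterior hxS (subset_convexHull ℝ S hs)
  have h1 := convexHull_subset_halfSpace hD hy
  have h2 := convexHull_subset_halfSpace hD' hxT
  have h3 := (hc s (hSL hs)).2.2 hs
  have h4 := (hc' s (hSL hs)).1
  refine (hc' s (hSL hs)).2.1 (le_antisymm ?_ h4)
  simp only [dotProduct_add, dotProduct_smul, dotProduct_sub, sub_dotProduct, smul_eq_mul] at *
  nlinarith

theorem IsDelaunay.eq_of_not_disjoint {S T : Set (Fin 6 → ℝ)} (hS : IsDelaunay S)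
    (hT : IsDelaunay T)
    (h : ¬ Disjoint (intrinsicInterior ℝ (convexHull ℝ S)) (intrinsicInterior ℝ (convexHull ℝ T))) :
    S = T := by
  obtain ⟨x, hxS, hxT⟩ := Set.not_disjoint_iff.1 h
  exact (hS.subset_of_mem_interiors hT hxS (intrinsicInterior_subset hxT)).antisymm
    (hT.subset_of_mem_interiors hS hxT (intrinsicInterior_subset hxS))

/-! ### The lattice -/

theorem isIntVec.add {u v : Fin 6 → ℝ} (hu : isIntVec u) (hv : isIntVec v) : isIntVec (u + v) :=
  fun r => by
    obtain ⟨k, hk⟩ := hu r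
    obtain ⟨l, hl⟩ := hv r
    exact ⟨k + l, by simp [hk, hl]⟩

theorem isIntVec.neg {u : Fin 6 → ℝ} (hu : isIntVec u) : isIntVec (-u) :=
  fun r => by
    obtain ⟨k, hk⟩ := hu r
    exact ⟨-k, by simp [hk]⟩

theorem isIntVec_stdE (r : Fin 6) : isIntVec (stdE r) := fun i => by
  by_cases h : i = r
  · exact ⟨1, by simp [stdE, h]⟩
  · exact ⟨0, by simp [stdE, h]⟩

theorem isIntVec_sum_stdE (A : Finset (Fin 6)) : isIntVec (∑ r ∈ A, stdE r) := fun i =>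
  ⟨if i ∈ A then 1 else 0, by simp [stdE, Finset.sum_apply, Pi.single_apply]⟩

theorem isIntVec_two_rhoHalf : isIntVec (rhoHalf + rhoHalf) := fun r =>
  ⟨1, by norm_num [rhoHalf]⟩

theorem inLatticeL.add {u v : Fin 6 → ℝ} (hu : inLatticeL u) (hv : inLatticeL v) :
    inLatticeL (u + v) := by
  rcases hu with hu | hu <;> rcases hv with hv | hv
  · exact .inl (hu.add hv)
  · exact .inr (by simpa [add_sub_assoc] using hu.add hv)
  · exact .inr (by simpa [add_sub_right_comm] using hu.add hv)
  · refine .inl ?_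
    convert (hu.add hv).add isIntVec_two_rhoHalf using 1
    abel

theorem inLatticeL.neg {u : Fin 6 → ℝ} (hu : inLatticeL u) : inLatticeL (-u) := by
  rcases hu with hu | hu
  · exact .inl hu.neg
  · refine .inr ?_
    convert (hu.add isIntVec_two_rhoHalf).neg using 1
    abel

theorem IsDelaunay.image_add {S : Set (Fin 6 → ℝ)} (hS : IsDelaunay S) {β : Fin 6 → ℝ}
    (hβ : inLatticeL β) (hsum : ∑ r, β r = 0) : IsDelaunay ((fun v => β + v) '' S) := by
  obtain ⟨hSL, c, d, hc⟩ := hS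
  refine ⟨?_, c - 2 • β, β ⬝ᵥ β - c ⬝ᵥ β + d, fun v hv => ?_⟩
  · rintro _ ⟨v, hv, rfl⟩
    exact ⟨hβ.add (hSL hv).1, by simp [Finset.sum_add_distrib, hsum, (hSL hv).2]⟩
  · have hmem : v - β ∈ latticeOne :=
      ⟨by simpa [sub_eq_add_neg] using hv.1.add hβ.neg, by simp [hsum, hv.2]⟩
    have key : v ⬝ᵥ v + (c - 2 • β) ⬝ᵥ v + (β ⬝ᵥ β - c ⬝ᵥ β + d) =
        (v - β) ⬝ᵥ (v - β) + c ⬝ᵥ (v - β) + d := by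
      simp only [sub_dotProduct, dotProduct_sub, smul_dotProduct, dotProduct_comm v β]
      simp only [nsmul_eq_mul]
      push_cast
      ring
    rw [key]
    refine ⟨(hc _ hmem).1, (hc _ hmem).2.trans ⟨fun h => ⟨_, h, by simp⟩, ?_⟩⟩
    rintro ⟨w, hw, rfl⟩
    simpa using hw

theorem IsDelaunay.image_sub {S : Set (Fin 6 → ℝ)} (hS : IsDelaunay S) {γ : Fin 6 → ℝ}
    (hγ : inLatticeL γ) (hsum : ∑ r, γ r = 2) : IsDelaunay ((fun v => γ - v) '' S) := by
  obtain ⟨hSL, c, d, hc⟩ := hS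
  refine ⟨?_, -c - 2 • γ, γ ⬝ᵥ γ + c ⬝ᵥ γ + d, fun v hv => ?_⟩
  · rintro _ ⟨v, hv, rfl⟩
    refine ⟨by simpa [sub_eq_add_neg] using hγ.add (hSL hv).1.neg, ?_⟩
    simp only [Pi.sub_apply, Finset.sum_sub_distrib, hsum, (hSL hv).2]
    norm_num
  · have hmem : γ - v ∈ latticeOne := by
      refine ⟨by simpa [sub_eq_add_neg] using hγ.add hv.1.neg, ?_⟩
      simp only [Pi.sub_apply, Finset.sum_sub_distrib, hsum, hv.2]
      norm_num
    have key : v ⬝ᵥ v + (-c - 2 • γ) ⬝ᵥ v + (γ ⬝ᵥ γ + c ⬝ᵥ γ + d) =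
        (γ - v) ⬝ᵥ (γ - v) + c ⬝ᵥ (γ - v) + d := by
      simp only [sub_dotProduct, dotProduct_sub, smul_dotProduct, neg_dotProduct,
        dotProduct_comm v γ]
      simp only [nsmul_eq_mul]
      push_cast
      ring
    rw [key]
    refine ⟨(hc _ hmem).1, (hc _ hmem).2.trans ⟨fun h => ⟨_, h, by simp⟩, ?_⟩⟩
    rintro ⟨w, hw, rfl⟩
    simpa using hw

/-! ### The model cells are Delaunay -/

/-- The power of `v` with respect to the circumsphere of a cell whose integral vertices are
the `e_r` with `r ∈ A`. -/
def power (A : Finset (Fin 6)) (v : Fin 6 → ℝ) : ℝ := v ⬝ᵥ v - ∑ r ∈ A, v r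

theorem power_eq_sum (A : Finset (Fin 6)) (v : Fin 6 → ℝ) :
    power A v = ∑ r, (v r * v r - if r ∈ A then v r else 0) := by
  simp [power, dotProduct, Finset.sum_sub_distrib]

theorem power_eq_affine (A : Finset (Fin 6)) (v : Fin 6 → ℝ) (d : ℝ) :
    power A v + d = v ⬝ᵥ v + (-∑ r ∈ A, stdE r) ⬝ᵥ v + d := by
  simp [power, sum_dotProduct, stdE, sub_eq_add_neg]

theorem power_stdE {A : Finset (Fin 6)} {r : Fin 6} (hr : r ∈ A) : power A (stdE r) = 0 := by
  simp [power, stdE, Pi.single_apply, hr]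

theorem sum_stdE (r : Fin 6) : ∑ i, stdE r i = 1 := by
  simp [stdE]

theorem sum_rhoHalf : ∑ i, rhoHalf i = 3 := by
  norm_num [rhoHalf]

theorem sum_sum_stdE (A : Finset (Fin 6)) : ∑ i, (∑ r ∈ A, stdE r) i = A.card := by
  simp [stdE, Finset.sum_apply, Pi.single_apply]

theorem eq_stdE {u : Fin 6 → ℝ} (hu : ∀ r, u r = 0 ∨ u r = 1) (hsum : ∑ r, u r = 1) :
    ∃ r, u = stdE r := by
  obtain ⟨r, hr⟩ : ∃ r, u r ≠ 0 := by
    by_contra! h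
    simp [h] at hsum
  have hr1 : u r = 1 := (hu r).resolve_left hr
  refine ⟨r, funext fun i => ?_⟩
  by_cases h : i = r
  · simp [h, hr1, stdE]
  · rw [← Finset.add_sum_erase _ _ (Finset.mem_univ r), hr1] at hsum
    have h0 : ∑ i ∈ Finset.univ.erase r, u i = 0 := by linarith
    rw [Finset.sum_eq_zero_iff_of_nonneg fun j _ => by rcases hu j with h | h <;> simp [h]] at h0
    simp [stdE, h, h0 i (by simp [h])]

theorem power_term_nonneg {A : Finset (Fin 6)} {v : Fin 6 → ℝ} (hv : isIntVec v) (r : Fin 6) :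
    0 ≤ v r * v r - if r ∈ A then v r else 0 := by
  obtain ⟨k, hk⟩ := hv r
  split_ifs
  · rw [hk]
    have : k ≤ k * k := by nlinarith [Int.le_self_sq k]
    have : (k : ℝ) ≤ k * k := mod_cast this
    linarith
  · nlinarith [mul_self_nonneg (v r)]

theorem power_nonneg {A : Finset (Fin 6)} {v : Fin 6 → ℝ} (hv : isIntVec v) : 0 ≤ power A v := by
  rw [power_eq_sum]
  exact Finset.sum_nonneg fun r _ => power_term_nonneg hv r

theorem exists_eq_stdE_of_power_eq_zero {A : Finset (Fin 6)} {v : Fin 6 → ℝ} (hv : isIntVec v)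
    (hsum : ∑ r, v r = 1) (h : power A v = 0) : ∃ r ∈ A, v = stdE r := by
  rw [power_eq_sum, Finset.sum_eq_zero_iff_of_nonneg fun r _ => power_term_nonneg hv r] at h
  have h01 : ∀ r, v r = 0 ∨ v r = 1 := fun r => by
    have := h r (Finset.mem_univ r)
    split_ifs at this
    · have : v r * (v r - 1) = 0 := by linarith
      rcases mul_eq_zero.1 this with h | h
      · exact .inl h
      · exact .inr (by linarith)
    · exact .inl (by simpa using this)
  obtain ⟨r, rfl⟩ := eq_stdE h01 hsum
  refine ⟨r, ?_, rfl⟩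
  by_contra hr
  have := h r (Finset.mem_univ r)
  simp [hr, stdE] at this

theorem stdE_mem_latticeOne (r : Fin 6) : stdE r ∈ latticeOne :=
  ⟨.inl (isIntVec_stdE r), sum_stdE r⟩

theorem isDelaunay_vertsI : IsDelaunay vertsI := by
  refine ⟨?_, -∑ r, stdE r, 0, fun v hv => ?_⟩
  · rintro _ ⟨r, rfl⟩
    exact stdE_mem_latticeOne r
  rw [← power_eq_affine, add_zero]
  rcases hv with ⟨hv | hv, hsum⟩
  · refine ⟨power_nonneg hv, fun h => ?_, ?_⟩
    · obtain ⟨r, -, hr⟩ := exists_eq_stdE_of_power_eq_zero hv hsum h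
      exact ⟨r, hr⟩
    · rintro ⟨r, rfl⟩
      exact power_stdE (Finset.mem_univ r)
  · have hpos : 0 < power Finset.univ v := by
      have hterm : ∀ r, 1 / 4 ≤ v r * v r := fun r => by
        obtain ⟨k, hk⟩ := hv r
        have hk' : v r = k + 1 / 2 := by simp [rhoHalf] at hk; linarith
        have : (0 : ℝ) ≤ k * (k + 1) := by
          have : (0 : ℤ) ≤ k * (k + 1) := by
            rcases le_or_gt 0 k with h | h <;> nlinarith
          exact_mod_cast this
        rw [hk']
        nlinarith
      have := Finset.sum_le_sum fun r (_ : r ∈ Finset.univ) => hterm r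
      norm_num at this
      simp only [power, dotProduct, hsum]
      linarith
    refine ⟨hpos.le, fun h => absurd h hpos.ne', ?_⟩
    rintro ⟨r, rfl⟩
    exact power_stdE (Finset.mem_univ r)

theorem power_reflect (a : Fin 6) (v : Fin 6 → ℝ) (hsum : ∑ r, v r = 1) :
    power {a}ᶜ (rhoHalf - stdE a - v) = power {a}ᶜ v := by
  have h (u : Fin 6 → ℝ) : power {a}ᶜ u = ∑ r, u r * u r - ∑ r, u r + u a := by
    rw [power, ← Finset.sum_add_sum_compl {a} u, Finset.sum_singleton, dotProduct]
    ring
  have hterm : ∀ r, (rhoHalf - stdE a - v) r * (rhoHalf - stdE a - v) r =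
      v r * v r - v r + 1 / 4 + if r = a then 2 * v r else 0 := fun r => by
    by_cases hr : r = a <;> simp [rhoHalf, stdE, hr] <;> ring
  have ha : (rhoHalf - stdE a - v) a = -1 / 2 - v a := by
    simp [rhoHalf, stdE]
    ring
  rw [h, h, ha, Finset.sum_congr rfl fun r _ => hterm r]
  simp only [Pi.sub_apply, Finset.sum_add_distrib, Finset.sum_sub_distrib, sum_rhoHalf, sum_stdE,
    hsum, Finset.sum_ite_eq', Finset.mem_univ, if_true, Finset.sum_const, Finset.card_univ,
    Fintype.card_fin]
  norm_num
  ring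

theorem power_translate {A : Finset (Fin 6)} (hA : A.card = 3) (v : Fin 6 → ℝ) :
    power Aᶜ (v - (rhoHalf - ∑ r ∈ Aᶜ, stdE r)) = power A v := by
  have hc : Aᶜ.card = 3 := by simp [Finset.card_compl, hA]
  simp only [power, dotProduct]
  rw [← Finset.sum_add_sum_compl A, ← Finset.sum_add_sum_compl A fun r => v r * v r]
  have h1 : ∀ r ∈ A, (v - (rhoHalf - ∑ r ∈ Aᶜ, stdE r)) r = v r - 1 / 2 := fun r hr => by
    simp [rhoHalf, stdE, Finset.sum_apply, Pi.single_apply, hr]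
  have h2 : ∀ r ∈ Aᶜ, (v - (rhoHalf - ∑ r ∈ Aᶜ, stdE r)) r = v r + 1 / 2 := fun r hr => by
    simp [rhoHalf, stdE, Finset.sum_apply, Pi.single_apply, Finset.mem_compl.1 hr]
    ring
  rw [Finset.sum_congr rfl h2, Finset.sum_congr rfl fun r hr => by rw [h1 r hr],
    Finset.sum_congr (s₁ := Aᶜ) rfl fun r hr => by rw [h2 r hr]]
  ring_nf
  simp only [Finset.sum_add_distrib, Finset.sum_sub_distrib, Finset.sum_const, hA, hc]
  norm_num
  ring

theorem isDelaunay_vertsII (a : Fin 6) : IsDelaunay (vertsII a) := by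
  have hself : ∀ v : Fin 6 → ℝ, rhoHalf - stdE a - (rhoHalf - stdE a - v) = v := fun v => by abel
  have hsumw : ∀ v : Fin 6 → ℝ, ∑ r, v r = 1 → ∑ r, (rhoHalf - stdE a - v) r = 1 := fun v hv => by
    simp only [Pi.sub_apply, Finset.sum_sub_distrib, sum_rhoHalf, sum_stdE, hv]
    norm_num
  have hzero : ∀ v ∈ vertsII a, power {a}ᶜ v = 0 := by
    rintro _ (⟨r, hr, rfl⟩ | ⟨r, hr, rfl⟩)
    · exact power_stdE (by simpa using hr)
    · rw [power_reflect _ _ (sum_stdE r), power_stdE (by simpa using hr)]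
  refine ⟨?_, -∑ r ∈ {a}ᶜ, stdE r, 0, fun v hv => ?_⟩
  · rintro _ (⟨r, -, rfl⟩ | ⟨r, -, rfl⟩)
    · exact stdE_mem_latticeOne r
    · refine ⟨.inr ?_, hsumw _ (sum_stdE r)⟩
      convert ((isIntVec_stdE a).add (isIntVec_stdE r)).neg using 1
      abel
  rw [← power_eq_affine, add_zero]
  rcases hv with ⟨hv | hv, hsum⟩
  · refine ⟨power_nonneg hv, fun h => ?_, hzero v⟩
    obtain ⟨r, hr, hr'⟩ := exists_eq_stdE_of_power_eq_zero hv hsum h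
    exact .inl ⟨r, by simpa using hr, hr'⟩
  · have hint : isIntVec (rhoHalf - stdE a - v) := by
      convert (hv.add (isIntVec_stdE a)).neg using 1
      abel
    refine ⟨power_reflect a v hsum ▸ power_nonneg hint, fun h => ?_, hzero v⟩
    rw [← power_reflect a v hsum] at h
    obtain ⟨r, hr, hr'⟩ := exists_eq_stdE_of_power_eq_zero hint (hsumw v hsum) h
    exact .inr ⟨r, by simpa using hr, by rw [← hr', hself]⟩

theorem isDelaunay_vertsIII {A : Finset (Fin 6)} (hA : A.card = 3) : IsDelaunay (vertsIII A) := by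
  have hc : Aᶜ.card = 3 := by simp [Finset.card_compl, hA]
  set τ : Fin 6 → ℝ := rhoHalf - ∑ r ∈ Aᶜ, stdE r with hτ
  have hτsum : ∑ r, τ r = 0 := by
    simp only [hτ, Pi.sub_apply, Finset.sum_sub_distrib, sum_rhoHalf, sum_sum_stdE, hc]
    norm_num
  have hvert : ∀ f ∈ Aᶜ, rhoHalf - ∑ r ∈ Aᶜ \ {f}, stdE r = τ + stdE f := fun f hf => by
    rw [hτ, ← Finset.sum_sdiff (Finset.singleton_subset_iff.2 hf), Finset.sum_singleton]
    abel
  have hzero : ∀ v ∈ vertsIII A, power A v = 0 := by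
    rintro _ (⟨r, hr, rfl⟩ | ⟨f, hf, rfl⟩)
    · exact power_stdE hr
    · rw [hvert f hf, ← power_translate hA, add_sub_cancel_left, power_stdE hf]
  refine ⟨?_, -∑ r ∈ A, stdE r, 0, fun v hv => ?_⟩
  · rintro _ (⟨r, -, rfl⟩ | ⟨f, hf, rfl⟩)
    · exact stdE_mem_latticeOne r
    · refine ⟨.inr ?_, ?_⟩
      · convert (isIntVec_sum_stdE (Aᶜ \ {f})).neg using 1
        abel
      · simp only [hvert f hf, Pi.add_apply, Finset.sum_add_distrib, hτsum, sum_stdE, zero_add]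
  rw [← power_eq_affine, add_zero]
  rcases hv with ⟨hv | hv, hsum⟩
  · refine ⟨power_nonneg hv, fun h => ?_, hzero v⟩
    exact .inl (exists_eq_stdE_of_power_eq_zero hv hsum h)
  · have hint : isIntVec (v - τ) := by
      convert hv.add (isIntVec_sum_stdE Aᶜ) using 1
      rw [hτ]
      abel
    refine ⟨power_translate hA v ▸ power_nonneg hint, fun h => ?_, hzero v⟩
    rw [← power_translate hA v] at h
    obtain ⟨f, hf, hf'⟩ := exists_eq_stdE_of_power_eq_zero hint
      (by simp [hsum, hτsum]) h
    exact .inr ⟨f, hf, by rw [hvert f hf, ← hf', add_sub_cancel]⟩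

theorem exists_isDelaunay_of_mem_tilingFamily {P : Set (Fin 6 → ℝ)} (hP : P ∈ tilingFamily) :
    ∃ S, IsDelaunay S ∧ P = convexHull ℝ S := by
  rcases hP with ⟨β, hβ, hs, rfl⟩ | ⟨γ, hγ, hs, rfl⟩ | ⟨β, hβ, hs, A, hA, rfl⟩ |
    ⟨γ, hγ, hs, A, hA, rfl⟩ | ⟨β, hβ, hs, a, rfl⟩
  · exact ⟨_, isDelaunay_vertsI.image_add hβ hs, polyPI_eq β⟩
  · exact ⟨_, isDelaunay_vertsI.image_sub hγ hs, polyPIhat_eq γ⟩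
  · exact ⟨_, (isDelaunay_vertsIII hA).image_add (.inl hβ) hs, polyPIII_eq β A⟩
  · exact ⟨_, (isDelaunay_vertsIII hA).image_sub (.inl hγ) hs, polyPIIIhat_eq γ A⟩
  · exact ⟨_, (isDelaunay_vertsII a).image_add hβ hs, polyPII_eq β a⟩

theorem convexHull_subset_hyperplane {S : Set (Fin 6 → ℝ)} (hS : S ⊆ latticeOne) :
    convexHull ℝ S ⊆ {α | ∑ r, α r = 1} := by
  refine convexHull_min (fun v hv => (hS hv).2) ?_
  intro u hu v hv s t _ _ hst
  simp only [Set.mem_ofPred_eq, Pi.add_apply, Pi.smul_apply, smul_eq_mul,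
    Finset.sum_add_distrib, ← Finset.mul_sum] at *
  rw [hu, hv, mul_one, mul_one, hst]

/-! ### Membership in the model cells -/

theorem mem_convexHull_vertsI {y : Fin 6 → ℝ} (hsum : ∑ r, y r = 1) (σ : Equiv.Perm (Fin 6))
    (h : ∀ i, 0 ≤ y (σ i)) : y ∈ convexHull ℝ vertsI := by
  have : y = ∑ r, y r • stdE r := by
    ext i
    simp [stdE, Finset.sum_apply, Pi.single_apply]
  rw [this]
  exact (convex_convexHull ℝ vertsI).sum_mem
    (fun r _ => (σ.surjective.forall (p := fun r => 0 ≤ y r)).2 h r) hsum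
    fun r _ => subset_convexHull ℝ _ ⟨r, rfl⟩

theorem sum_smul_add_sum_smul_mem_convexHull {S : Set (Fin 6 → ℝ)} {A B : Finset (Fin 6)}
    {w u : Fin 6 → ℝ} {p q : Fin 6 → Fin 6 → ℝ} (hw : ∀ r ∈ A, 0 ≤ w r) (hu : ∀ r ∈ B, 0 ≤ u r)
    (hsum : ∑ r ∈ A, w r + ∑ r ∈ B, u r = 1) (hp : ∀ r ∈ A, p r ∈ S) (hq : ∀ r ∈ B, q r ∈ S) :
    ∑ r ∈ A, w r • p r + ∑ r ∈ B, u r • q r ∈ convexHull ℝ S := by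
  have := (convex_convexHull ℝ S).sum_mem (t := A.disjSum B) (w := Sum.elim w u)
    (z := Sum.elim p q) ?_ ?_ ?_
  · simpa [Finset.sum_disjSum] using this
  · simpa using ⟨hw, hu⟩
  · simpa [Finset.sum_disjSum] using hsum
  · simpa using ⟨fun r hr => subset_convexHull ℝ S (hp r hr),
      fun r hr => subset_convexHull ℝ S (hq r hr)⟩

theorem mem_convexHull_vertsII {y : Fin 6 → ℝ} (hsum : ∑ r, y r = 1) (σ : Equiv.Perm (Fin 6))
    (j : Fin 6) (h : ∑ i ∈ {j}ᶜ, |y (σ i) + y (σ j)| ≤ 1) :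
    y ∈ convexHull ℝ (vertsII (σ j)) := by
  set a := σ j with ha
  have h' : ∑ r ∈ {a}ᶜ, |y r + y a| ≤ 1 := by
    convert h using 1
    exact (Finset.sum_equiv σ (by simp [ha]) (by simp)).symm
  have hsum' : ∑ r ∈ {a}ᶜ, (y r + y a) = 1 + 4 * y a := by
    rw [← Finset.sum_add_sum_compl {a} y, Finset.sum_singleton] at hsum
    simp only [Finset.sum_add_distrib, Finset.sum_const, Finset.card_compl, Fintype.card_fin,
      Finset.card_singleton]
    norm_num
    linarith
  set T := 1 - ∑ r ∈ {a}ᶜ, |y r + y a| with hT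
  have hT0 : 0 ≤ T := by linarith
  -- the barycentric coordinates, with the slack `T` spread evenly
  set w : Fin 6 → ℝ := fun r => (|y r + y a| + (y r + y a)) / 2 + T / 10 with hw
  set u : Fin 6 → ℝ := fun r => (|y r + y a| - (y r + y a)) / 2 + T / 10 with hu
  have hwsum : ∑ r ∈ {a}ᶜ, w r = 1 + 2 * y a := by
    simp only [hw, Finset.sum_add_distrib, ← Finset.sum_div, Finset.sum_const, Finset.card_compl,
      Fintype.card_fin, Finset.card_singleton] at hsum' ⊢
    norm_num at hsum' ⊢
    linarith
  have husum : ∑ r ∈ {a}ᶜ, u r = -2 * y a := by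
    simp only [hu, Finset.sum_add_distrib, Finset.sum_sub_distrib, ← Finset.sum_div,
      Finset.sum_const, Finset.card_compl, Fintype.card_fin, Finset.card_singleton] at hsum' ⊢
    norm_num at hsum' ⊢
    linarith
  have hmem := sum_smul_add_sum_smul_mem_convexHull (S := vertsII a) (A := {a}ᶜ) (B := {a}ᶜ)
    (w := w) (u := u) (p := stdE) (q := fun r => rhoHalf - stdE a - stdE r)
    (fun r _ => by have := neg_abs_le (y r + y a); simp only [hw]; linarith)
    (fun r _ => by have := le_abs_self (y r + y a); simp only [hu]; linarith)
    (by rw [hwsum, husum]; ring)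
    (fun r hr => .inl ⟨r, by simpa using hr, rfl⟩)
    (fun r hr => .inr ⟨r, by simpa using hr, rfl⟩)
  convert hmem using 1
  simp only [smul_sub, Finset.sum_sub_distrib, ← Finset.sum_smul, husum]
  ext i
  by_cases hi : i = a
  · simp [hi, stdE, rhoHalf, Finset.sum_apply, Pi.single_apply]
    ring
  · simp [hi, stdE, rhoHalf, Finset.sum_apply, Pi.single_apply, hw, hu]
    ring

theorem mem_convexHull_vertsIII {y : Fin 6 → ℝ} (hsum : ∑ r, y r = 1) (σ : Equiv.Perm (Fin 6))
    {B : Finset (Fin 6)} (hB : B.card = 3) (h : ∀ i ∈ B, 0 ≤ y (σ i) + ∑ j ∈ Bᶜ, y (σ j))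
    (h' : ∀ i ∈ Bᶜ, ∑ j ∈ Bᶜ, y (σ j) ≤ y (σ i)) :
    y ∈ convexHull ℝ (vertsIII (B.map σ.toEmbedding)) := by
  have hc : (B.map σ.toEmbedding)ᶜ = Bᶜ.map σ.toEmbedding := by
    ext r
    obtain ⟨i, rfl⟩ := σ.surjective r
    simp
  set A := B.map σ.toEmbedding with hAB
  have hA : A.card = 3 := by simp [hAB, hB]
  have hAc : Aᶜ.card = 3 := by simp [Finset.card_compl, hA]
  set s := ∑ r ∈ Aᶜ, y r with hs
  have hs' : ∑ j ∈ Bᶜ, y (σ j) = s := by simp [hs, hc]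
  rw [hs'] at h h'
  have hsA : ∑ r ∈ A, y r = 1 - s := by
    rw [← Finset.sum_add_sum_compl A y] at hsum
    linarith
  have hmem := sum_smul_add_sum_smul_mem_convexHull (S := vertsIII A) (A := A) (B := Aᶜ)
    (w := fun r => y r + s) (u := fun r => y r - s) (p := stdE)
    (q := fun f => rhoHalf - ∑ r ∈ Aᶜ \ {f}, stdE r)
    (fun r hr => by
      obtain ⟨i, hi, rfl⟩ := Finset.mem_map.1 hr
      exact h i hi)
    (fun r hr => by
      rw [hc] at hr
      obtain ⟨i, hi, rfl⟩ := Finset.mem_map.1 hr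
      exact sub_nonneg.2 (h' i hi))
    (by
      simp only [Finset.sum_add_distrib, Finset.sum_sub_distrib, Finset.sum_const, hA, hAc, hsA,
        ← hs]
      norm_num)
    (fun r hr => .inl ⟨r, hr, rfl⟩) (fun r hr => .inr ⟨r, hr, rfl⟩)
  have hvert : ∀ f ∈ Aᶜ, (y f - s) • (rhoHalf - ∑ r ∈ Aᶜ \ {f}, stdE r) =
      (y f - s) • (rhoHalf - ∑ r ∈ Aᶜ, stdE r) + (y f - s) • stdE f := fun f hf => by
    rw [← smul_add, ← Finset.sum_sdiff (Finset.singleton_subset_iff.2 hf), Finset.sum_singleton]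
    congr 1
    abel
  have husum : ∑ f ∈ Aᶜ, (y f - s) = -2 * s := by
    simp only [Finset.sum_sub_distrib, Finset.sum_const, hAc, ← hs]
    norm_num
    ring
  convert hmem using 1
  rw [Finset.sum_congr (s₁ := Aᶜ) rfl hvert, Finset.sum_add_distrib, ← Finset.sum_smul, husum]
  ext i
  by_cases hi : i ∈ A
  · simp [hi, stdE, rhoHalf, Finset.sum_apply, Pi.single_apply]
    ring
  · simp [hi, stdE, rhoHalf, Finset.sum_apply, Pi.single_apply]
    ring

/-! ### Covering -/

theorem exists_top_finset (y : Fin 6 → ℝ) :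
    ∀ k ≤ 6, ∃ S : Finset (Fin 6), S.card = k ∧ ∀ i ∈ S, ∀ j ∉ S, y j ≤ y i := by
  intro k
  induction k with
  | zero => exact fun _ => ⟨∅, by simp⟩
  | succ k ih =>
    intro hk
    obtain ⟨S, hS, htop⟩ := ih (by omega)
    have hne : Sᶜ.Nonempty := by
      rw [← Finset.card_pos, Finset.card_compl, Fintype.card_fin]
      omega
    obtain ⟨m, hm, hmax⟩ := Finset.exists_max_image Sᶜ y hne
    have hm' : m ∉ S := Finset.mem_compl.1 hm
    refine ⟨insert m S, by rw [Finset.card_insert_of_notMem hm', hS], fun i hi j hj => ?_⟩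
    rw [Finset.mem_insert, not_or] at hj
    rcases Finset.mem_insert.1 hi with rfl | hi
    · exact hmax j (Finset.mem_compl.2 hj.2)
    · exact htop i hi j hj.2

theorem exists_isIntVec_sub_le_one (x : Fin 6 → ℝ) (hx : ∑ r, x r = 1) :
    ∃ n, isIntVec n ∧ ∑ r, n r = 0 ∧ ∀ i j, (x - n) i - (x - n) j ≤ 1 := by
  set m : Fin 6 → ℤ := fun r => ⌈x r⌉ - 1 with hm
  have hlo : ∀ r, 0 < x r - m r := fun r => by
    have := Int.ceil_lt_add_one (x r)
    simp only [hm]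
    push_cast
    linarith
  have hhi : ∀ r, x r - m r ≤ 1 := fun r => by
    have := Int.le_ceil (x r)
    simp only [hm]
    push_cast
    linarith
  have hK : (0 : ℝ) < 1 - (∑ r, m r : ℤ) ∧ (1 : ℝ) - (∑ r, m r : ℤ) ≤ 6 := by
    push_cast
    rw [← hx, ← Finset.sum_sub_distrib]
    refine ⟨Finset.sum_pos (fun r _ => hlo r) Finset.univ_nonempty, ?_⟩
    have := Finset.sum_le_sum fun r (_ : r ∈ Finset.univ) => hhi r
    norm_num at this ⊢
    linarith
  have hK1 : ∑ r, m r < 1 := by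
    have := hK.1
    exact_mod_cast sub_pos.1 this
  have hK2 : -5 ≤ ∑ r, m r := by
    have := hK.2
    have : (-5 : ℝ) ≤ (∑ r, m r : ℤ) := by linarith
    exact_mod_cast this
  obtain ⟨S, hS, htop⟩ := exists_top_finset (fun r => x r - m r) (-∑ r, m r).toNat (by omega)
  refine ⟨fun r => ((m r + if r ∈ S then 1 else 0 : ℤ) : ℝ), fun r => ⟨_, rfl⟩, ?_, fun i j => ?_⟩
  · rw [← Int.cast_sum, Finset.sum_add_distrib]
    have : (∑ r, if r ∈ S then (1 : ℤ) else 0) = S.card := by simp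
    rw [this, hS]
    norm_cast
    omega
  · have h1 := hlo i
    have h2 := hhi i
    have h3 := hlo j
    have h4 := hhi j
    simp only [Pi.sub_apply]
    by_cases hi : i ∈ S <;> by_cases hj : j ∈ S <;> simp only [hi, hj, if_true, if_false] <;>
      push_cast <;> try linarith
    have := htop j hj i hi
    linarith

theorem sum_abs_le_one {a b c d e : ℝ} (hab : b ≤ a) (hbc : c ≤ b) (hcd : d ≤ c) (hde : e ≤ d)
    (h₀ : a + b + c + d + e ≤ 1) (h₁ : a + b + c + d - e ≤ 1) (h₂ : a + b + c - d - e ≤ 1)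
    (h₃ : a + b - c - d - e ≤ 1) (h₄ : a - b - c - d - e ≤ 1) (h₅ : -a - b - c - d - e ≤ 1) :
    |a| + (|b| + (|c| + (|d| + |e|))) ≤ 1 := by
  rcases abs_cases a with ha | ha <;> rcases abs_cases b with hb | hb <;>
    rcases abs_cases c with hc | hc <;> rcases abs_cases d with hd | hd <;>
    rcases abs_cases e with he | he <;> linarith

/-- After translating `x` into the closed fundamental alcove by `n` and `σ`, one of eight cells
contains it. -/
theorem exists_mem_tilingFamily_of_antitone {x n z : Fin 6 → ℝ} (hx : ∑ r, x r = 1)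
    (hn : isIntVec n) (hnsum : ∑ r, n r = 0) (hz : x - n = z) (σ : Equiv.Perm (Fin 6))
    (hσ : Antitone (z ∘ σ)) (h50 : z (σ 0) - z (σ 5) ≤ 1) :
    ∃ P ∈ tilingFamily, x ∈ P := by
  have hzsum : ∑ r, z r = 1 := by simp [← hz, hx, hnsum]
  have h01 : z (σ 1) ≤ z (σ 0) := hσ (by decide)
  have h12 : z (σ 2) ≤ z (σ 1) := hσ (by decide)
  have h23 : z (σ 3) ≤ z (σ 2) := hσ (by decide)
  have h34 : z (σ 4) ≤ z (σ 3) := hσ (by decide)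
  have h45 : z (σ 5) ≤ z (σ 4) := hσ (by decide)
  have hzσ : z (σ 0) + z (σ 1) + z (σ 2) + z (σ 3) + z (σ 4) + z (σ 5) = 1 := by
    rw [← hzsum, ← Equiv.sum_comp σ, Fin.sum_univ_six]
  -- vectors are described by their coordinates in the order given by `σ`
  have hpull (b : Fin 6 → ℝ) : ∑ r, b (σ.symm r) = ∑ i, b i := Equiv.sum_comp σ.symm b
  have hpull_add (b : Fin 6 → ℝ) (t : ℝ) (hb : ∑ i, b i = t) :
      ∑ r, (n + b ∘ σ.symm) r = t := by
    simp [Finset.sum_add_distrib, hnsum, hpull, hb]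
  have hint (b : Fin 6 → ℝ) (hb : isIntVec b) : isIntVec (n + b ∘ σ.symm) :=
    hn.add fun r => hb (σ.symm r)
  have hhalf (b : Fin 6 → ℝ) (hb : isIntVec (b - rhoHalf)) : inLatticeL (n + b ∘ σ.symm) := by
    refine .inr ?_
    convert hn.add (v := (b - rhoHalf) ∘ σ.symm) (fun r => hb (σ.symm r)) using 1
    rw [add_sub_assoc]
    rfl
  have hsub (b : Fin 6 → ℝ) (i : Fin 6) : (x - (n + b ∘ σ.symm)) (σ i) = z (σ i) - b i := by
    simp [← hz]
    ring
  have hsub' (b : Fin 6 → ℝ) (i : Fin 6) : ((n + b ∘ σ.symm) - x) (σ i) = b i - z (σ i) := by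
    simp [← hz]
    ring
  have hone : isIntVec ![1, 1, 0, 0, 0, 0] := fun r =>
    ⟨![1, 1, 0, 0, 0, 0] r, by fin_cases r <;> simp⟩
  have hcenter : isIntVec (![1 / 2, 1 / 2, 1 / 2, -1 / 2, -1 / 2, -1 / 2] - rhoHalf) := fun r =>
    ⟨![0, 0, 0, -1, -1, -1] r, by fin_cases r <;> norm_num [rhoHalf]⟩
  have htop : isIntVec (![1 / 2, 1 / 2, 1 / 2, 1 / 2, 1 / 2, -1 / 2] - rhoHalf) := fun r =>
    ⟨![0, 0, 0, 0, 0, -1] r, by fin_cases r <;> norm_num [rhoHalf]⟩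
  have hone_sum : ∑ i, (![1, 1, 0, 0, 0, 0] : Fin 6 → ℝ) i = 2 := by
    norm_num [Fin.sum_univ_succ]
  have hcenter_sum :
      ∑ i, (![1 / 2, 1 / 2, 1 / 2, -1 / 2, -1 / 2, -1 / 2] : Fin 6 → ℝ) i = 0 := by
    norm_num [Fin.sum_univ_succ]
  have htop_sum : ∑ i, (![1 / 2, 1 / 2, 1 / 2, 1 / 2, 1 / 2, -1 / 2] : Fin 6 → ℝ) i = 2 := by
    norm_num [Fin.sum_univ_succ]
  have hx_sub (β : Fin 6 → ℝ) (h : ∑ r, β r = 0) : ∑ r, (x - β) r = 1 := by simp [hx, h]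
  have hsub_x (γ : Fin 6 → ℝ) (h : ∑ r, γ r = 2) : ∑ r, (γ - x) r = 1 := by
    simp only [Pi.sub_apply, Finset.sum_sub_distrib, hx, h]
    norm_num
  by_cases hI : 0 ≤ z (σ 5)
  · refine ⟨_, .inl ⟨n, .inl hn, hnsum, rfl⟩, ?_⟩
    rw [polyPI_eq]
    refine mem_convexHull_image_add ?_
    rw [hz]
    exact mem_convexHull_vertsI hzsum σ fun i => hI.trans (hσ (Fin.le_last i))
  by_cases hIhat : z (σ 2) ≤ 0
  · have hs := hpull_add _ _ hone_sum
    refine ⟨_, .inr (.inl ⟨_, .inl (hint _ hone), hs, rfl⟩), ?_⟩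
    rw [polyPIhat_eq]
    refine mem_convexHull_image_sub (mem_convexHull_vertsI (hsub_x _ hs) σ fun i => ?_)
    rw [hsub']
    fin_cases i <;> simp <;> linarith
  by_cases hI' : 1 / 2 ≤ z (σ 2)
  · have hs := hpull_add _ _ hcenter_sum
    refine ⟨_, .inl ⟨_, hhalf _ hcenter, hs, rfl⟩, ?_⟩
    rw [polyPI_eq]
    refine mem_convexHull_image_add (mem_convexHull_vertsI (hx_sub _ hs) σ fun i => ?_)
    rw [hsub]
    fin_cases i <;> simp <;> linarith
  by_cases hIhat' : z (σ 5) ≤ -1 / 2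
  · have hs := hpull_add _ _ htop_sum
    refine ⟨_, .inr (.inl ⟨_, hhalf _ htop, hs, rfl⟩), ?_⟩
    rw [polyPIhat_eq]
    refine mem_convexHull_image_sub (mem_convexHull_vertsI (hsub_x _ hs) σ fun i => ?_)
    rw [hsub']
    fin_cases i <;> simp <;> linarith
  push Not at hI hIhat hI' hIhat'
  rcases le_total (z (σ 0) + z (σ 1)) 1 with hA | hA <;>
    rcases le_total (z (σ 3) + z (σ 4)) 0 with hB | hB
  · refine ⟨_, .inr (.inr (.inl ⟨n, hn, hnsum, ({0, 1, 2} : Finset (Fin 6)).map σ.toEmbedding,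
      by simp, rfl⟩)), ?_⟩
    rw [polyPIII_eq]
    have hc : ({0, 1, 2} : Finset (Fin 6))ᶜ = {3, 4, 5} := by decide
    refine mem_convexHull_image_add ?_
    rw [hz]
    refine mem_convexHull_vertsIII hzsum σ (by simp) ?_ ?_
    · simp [hc]
      refine ⟨?_, ?_, ?_⟩ <;> linarith
    · simp [hc]
      refine ⟨?_, ?_, ?_⟩ <;> linarith
  · refine ⟨_, .inr (.inr (.inr (.inr ⟨n, .inl hn, hnsum, σ 5, rfl⟩))), ?_⟩
    rw [polyPII_eq]
    have hc : ({5} : Finset (Fin 6))ᶜ = {0, 1, 2, 3, 4} := by decide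
    refine mem_convexHull_image_add ?_
    rw [hz]
    refine mem_convexHull_vertsII hzsum σ 5 ?_
    simp [hc]
    refine sum_abs_le_one ?_ ?_ ?_ ?_ ?_ ?_ ?_ ?_ ?_ ?_ <;> linarith
  · have hs := hpull_add _ _ hcenter_sum
    refine ⟨_, .inr (.inr (.inr (.inr ⟨_, hhalf _ hcenter, hs, σ 2, rfl⟩))), ?_⟩
    rw [polyPII_eq]
    refine mem_convexHull_image_add (mem_convexHull_vertsII (hx_sub _ hs) σ 2 ?_)
    have hc : ({2} : Finset (Fin 6))ᶜ = {3, 4, 5, 0, 1} := by decide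
    simp only [hsub, hc]
    simp
    refine sum_abs_le_one ?_ ?_ ?_ ?_ ?_ ?_ ?_ ?_ ?_ ?_ <;> linarith
  · have hs := hpull_add _ _ hone_sum
    refine ⟨_, .inr (.inr (.inr (.inl ⟨_, hint _ hone, hs,
      ({0, 1, 5} : Finset (Fin 6)).map σ.toEmbedding, by simp, rfl⟩))), ?_⟩
    rw [polyPIIIhat_eq]
    have hc : ({0, 1, 5} : Finset (Fin 6))ᶜ = {2, 3, 4} := by decide
    refine mem_convexHull_image_sub (mem_convexHull_vertsIII (hsub_x _ hs) σ (by simp) ?_ ?_)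
    · simp only [hsub', hc]
      simp
      refine ⟨?_, ?_, ?_⟩ <;> linarith
    · simp only [hsub', hc]
      simp
      refine ⟨?_, ?_, ?_⟩ <;> linarith

theorem exists_mem_tilingFamily (x : Fin 6 → ℝ) (hx : ∑ r, x r = 1) :
    ∃ P ∈ tilingFamily, x ∈ P := by
  obtain ⟨n, hn, hnsum, hdiff⟩ := exists_isIntVec_sub_le_one x hx
  refine exists_mem_tilingFamily_of_antitone hx hn hnsum rfl (Tuple.sort (-(x - n)))
    (fun i j hij => ?_) (hdiff _ _)
  exact neg_le_neg_iff.1 (Tuple.monotone_sort (-(x - n)) hij)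

/-- The polytopes of the family `F` tile the hyperplane `H = {α : Σ α_r = 1}`:
their union is `H` and distinct polytopes have disjoint relative interiors. -/
theorem tilingFamily_tiles_hyperplane :
    (⋃₀ tilingFamily = {α : Fin 6 → ℝ | ∑ r, α r = 1}) ∧
    (∀ P ∈ tilingFamily, ∀ Q ∈ tilingFamily, P ≠ Q →
      Disjoint (intrinsicInterior ℝ P) (intrinsicInterior ℝ Q)) := by
  refine ⟨Set.Subset.antisymm (Set.sUnion_subset fun P hP => ?_) fun x hx => ?_,
    fun P hP Q hQ hne => ?_⟩
  · obtain ⟨S, hS, rfl⟩ := exists_isDelaunay_of_mem_tilingFamily hP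
    exact convexHull_subset_hyperplane hS.1
  · exact Set.mem_sUnion.2 (exists_mem_tilingFamily x hx)
  · obtain ⟨S, hS, rfl⟩ := exists_isDelaunay_of_mem_tilingFamily hP
    obtain ⟨T, hT, rfl⟩ := exists_isDelaunay_of_mem_tilingFamily hQ
    by_contra h
    exact hne (congrArg _ (hS.eq_of_not_disjoint hT h))
end
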